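/- Let f: ℂ² → ℂ be a reduced polynomial of degree d that is transversal at infinity (its projectivization V ⊂ ℂP² meets the line at infinity in d distinct points). If μ = 0, i.e., the curve F_0 = f^{-1}(0) is contractible, then f is a homogeneous polynomial up to an affine change of coordinates (equivalently, V is a cone). -/

import Mathlib

open MvPolynomial

theorem exists_continuous_log_of_contractibleSpace {X : Type*} [TopologicalSpace X]
    [ContractibleSpace X] {g : X → ℂ} (hg : Continuous g) (h0 : ∀ x, g x ≠ 0) :
    ∃ h : X → ℂ, Continuous h ∧ ∀ x, Complex.exp (h x) = g x := by
  let G : C(X, {z : ℂ // z ≠ 0}) := ⟨fun x => ⟨g x, h0 x⟩, by fun_prop⟩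
  obtain ⟨c, ⟨H⟩⟩ := id_nullhomotopic X
  let K : C(unitInterval × X, {z : ℂ // z ≠ 0}) := G.comp (H.symm : C(unitInterval × X, X))
  let f : C(X, ℂ) := ContinuousMap.const X (Complex.log (g c))
  have hK : ∀ a, K (0, a) = ⟨_, (f a).exp_ne_zero⟩ := by
    intro a
    apply Subtype.ext
    simp [K, G, f, Complex.exp_log (h0 c)]
  refine ⟨fun x => Complex.isCoveringMap_exp.liftHomotopy K f hK (1, x), by fun_prop, fun x => ?_⟩
  have := congr_fun (Complex.isCoveringMap_exp.liftHomotopy_lifts K f hK) (1, x)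
  simpa [K, G] using congr_arg Subtype.val this

/-- A Mayer–Vietoris argument: if a contractible space is covered by two closed sets `A`, `B`, then
points of `A ∩ B` connected both inside `A` and inside `B` cannot be separated inside `A ∩ B`. -/
theorem not_separated_of_contractibleSpace {X : Type*} [TopologicalSpace X]
    [ContractibleSpace X] [NormalSpace X] {A B W₁ W₂ S S' : Set X}
    (hA : IsClosed A) (hB : IsClosed B) (hAB : A ∪ B = Set.univ)
    (hW₁ : IsClosed W₁) (hW₂ : IsClosed W₂) (hW : Disjoint W₁ W₂) (hABW : A ∩ B ⊆ W₁ ∪ W₂)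
    (hS : IsPreconnected S) (hSA : S ⊆ A) (hS' : IsPreconnected S') (hSB : S' ⊆ B)
    {z z' : X} (hz : z ∈ S ∩ S') (hz' : z' ∈ S ∩ S') (hzW : z ∈ W₁) (hzW' : z' ∈ W₂) : False := by
  classical
  obtain ⟨α, hα₁, hα₂, -⟩ := exists_continuous_zero_one_of_isClosed hW₁ hW₂ hW
  let e : X → ℂ := fun x => Complex.exp (2 * Real.pi * Complex.I * α x)
  have he : Continuous e := by fun_prop
  have he1 : ∀ x ∈ A ∩ B, e x = 1 := by
    intro x hx
    rcases hABW hx with h | h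
    · simp [e, hα₁ h]
    · simp [e, hα₂ h]
  let g : X → ℂ := fun x => if x ∈ A then e x else 1
  have hgA : ∀ x ∈ A, g x = e x := fun x hx => if_pos hx
  have hgB : ∀ x ∈ B, g x = 1 := by
    intro x hx
    by_cases h : x ∈ A
    · rw [hgA x h, he1 x ⟨h, hx⟩]
    · exact if_neg h
  have hg : Continuous g := by
    rw [← continuousOn_univ, ← hAB]
    exact (he.continuousOn.congr hgA).union_of_isClosed
      ((continuousOn_const (c := (1 : ℂ))).congr hgB) hA hB
  have hg0 : ∀ x, g x ≠ 0 := by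
    intro x
    by_cases h : x ∈ A
    · rw [hgA x h]; exact Complex.exp_ne_zero _
    · simp [g, h]
  obtain ⟨h, hh, hhg⟩ := exists_continuous_log_of_contractibleSpace hg hg0
  have h2 : (2 * Real.pi * Complex.I : ℂ) ≠ 0 := by simp [Real.pi_ne_zero]
  have key : ∀ (T : Set X) (k : X → ℂ), IsPreconnected T → Continuous k →
      (∀ x ∈ T, Complex.exp (k x) = 1) → ∀ x ∈ T, ∀ y ∈ T, k x = k y := by
    intro T k hT hk hk1 x hx y hy
    have hint : ∀ x ∈ T, ∃ n : ℤ, k x = n * (2 * Real.pi * Complex.I) := fun x hx =>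
      Complex.exp_eq_one_iff.1 (hk1 x hx)
    let r : X → ℝ := fun x => (k x / (2 * Real.pi * Complex.I)).re
    have hr : Continuous r := by fun_prop
    have hrT : Set.MapsTo r T (Set.range ((↑) : ℤ → ℝ)) := by
      intro x hx
      obtain ⟨n, hn⟩ := hint x hx
      refine ⟨n, ?_⟩
      simp only [r, hn]
      rw [mul_div_cancel_right₀ _ h2]
      simp
    have hd : IsDiscrete (Set.range ((↑) : ℤ → ℝ)) := by
      rw [← Set.image_univ]
      exact IsDiscrete.univ.image Int.isClosedEmbedding_coe_real.isInducing
    have hrxy : r x = r y := hT.constant_of_mapsTo hd hr.continuousOn hrT hx hy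
    obtain ⟨n, hn⟩ := hint x hx
    obtain ⟨m, hm⟩ := hint y hy
    simp only [r, hn, hm, mul_div_cancel_right₀ _ h2] at hrxy
    have : n = m := by exact_mod_cast hrxy
    rw [hn, hm, this]
  have h1 := key S' h hS' hh (fun x hx => by rw [hhg, hgB x (hSB hx)]) z hz.2 z' hz'.2
  have h3 := key S (fun x => h x - 2 * Real.pi * Complex.I * α x) hS (by fun_prop)
    (fun x hx => by
      rw [Complex.exp_sub, hhg, hgA x (hSA hx), div_self (Complex.exp_ne_zero _)]) z hz.1 z' hz'.1
  simp only [h1, hα₁ hzW, hα₂ hzW'] at h3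
  simp only [Pi.zero_apply, Pi.one_apply, Complex.ofReal_zero, mul_zero, sub_zero,
    Complex.ofReal_one, mul_one] at h3
  exact h2 (sub_eq_self.1 h3.symm)

section BinaryForm

theorem MvPolynomial.IsHomogeneous.add_eq_of_mem_support {φ : MvPolynomial (Fin 2) ℂ} {n : ℕ}
    (h : φ.IsHomogeneous n) {m : Fin 2 →₀ ℕ} (hm : m ∈ φ.support) : m 0 + m 1 = n := by
  rw [h.degree_eq_sum_deg_support hm, ← Finsupp.degree_apply, Finsupp.degree_eq_sum,
    Fin.sum_univ_two]

theorem MvPolynomial.IsHomogeneous.eval_pair_mul {φ : MvPolynomial (Fin 2) ℂ} {n : ℕ}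
    (h : φ.IsHomogeneous n) (t a b : ℂ) :
    eval ![t * a, t * b] φ = t ^ n * eval ![a, b] φ := by
  simp_rw [eval_eq', Finset.mul_sum]
  refine Finset.sum_congr rfl fun m hm => ?_
  simp only [Fin.prod_univ_two, Matrix.cons_val_zero, Matrix.cons_val_one, mul_pow,
    ← h.add_eq_of_mem_support hm]
  ring

theorem aeval_pair_monomial {R : Type*} [CommRing R] [Algebra ℂ R] (m : Fin 2 →₀ ℕ) (c : ℂ)
    (a : R) : MvPolynomial.aeval ![Polynomial.X, Polynomial.C a] (monomial m c) =
      Polynomial.C (algebraMap ℂ R c * a ^ m 1) * Polynomial.X ^ m 0 := by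
  rw [aeval_monomial, Finsupp.prod_fintype _ _ (by simp), Fin.prod_univ_two,
    Polynomial.algebraMap_apply]
  simp only [Matrix.cons_val_zero, Matrix.cons_val_one, map_mul, map_pow]
  ring

theorem MvPolynomial.IsHomogeneous.natDegree_aeval_pair_le {R : Type*} [CommRing R] [Algebra ℂ R]
    {φ : MvPolynomial (Fin 2) ℂ} {n : ℕ} (h : φ.IsHomogeneous n) (a : R) :
    (MvPolynomial.aeval ![Polynomial.X, Polynomial.C a] φ).natDegree ≤ n := by
  rw [φ.as_sum, map_sum]
  refine Polynomial.natDegree_sum_le_of_forall_le _ _ fun m hm => ?_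
  rw [aeval_pair_monomial]
  exact (Polynomial.natDegree_C_mul_X_pow_le _ _).trans
    ((Nat.le_add_right _ _).trans_eq (h.add_eq_of_mem_support hm))

theorem MvPolynomial.IsHomogeneous.coeff_aeval_pair {R : Type*} [CommRing R] [Algebra ℂ R]
    {φ : MvPolynomial (Fin 2) ℂ} {n : ℕ} (h : φ.IsHomogeneous n) (a : R) :
    (MvPolynomial.aeval ![Polynomial.X, Polynomial.C a] φ).coeff n =
      algebraMap ℂ R (eval ![1, 0] φ) := by
  rw [eval_eq', map_sum]
  conv_lhs => rw [φ.as_sum, map_sum, Polynomial.finsetSum_coeff]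
  refine Finset.sum_congr rfl fun m hm => ?_
  rw [aeval_pair_monomial, Polynomial.coeff_C_mul_X_pow, Fin.prod_univ_two,
    ← h.add_eq_of_mem_support hm]
  rcases Nat.eq_zero_or_pos (m 1) with h1 | h1
  · simp [h1]
  · simp [h1.ne']

theorem Polynomial.coeff_sum_of_natDegree_le {R : Type*} [CommRing R] {F : ℕ → Polynomial R}
    (hF : ∀ k, (F k).natDegree ≤ k) (n : ℕ) :
    (∑ k ∈ Finset.range (n + 1), F k).natDegree ≤ n ∧
      (∑ k ∈ Finset.range (n + 1), F k).coeff n = (F n).coeff n := by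
  refine ⟨Polynomial.natDegree_sum_le_of_forall_le _ _ fun k hk => (hF k).trans ?_, ?_⟩
  · exact Nat.lt_succ_iff.1 (Finset.mem_range.1 hk)
  · rw [Polynomial.finsetSum_coeff, Finset.sum_range_succ, Finset.sum_eq_zero, zero_add]
    exact fun k hk => Polynomial.coeff_eq_zero_of_natDegree_lt
      ((hF k).trans_lt (Finset.mem_range.1 hk))

theorem bind₁_toMvPolynomial_of_mul_eq_one {M N : Matrix (Fin 2) (Fin 2) ℂ} (h : M * N = 1)
    (φ : MvPolynomial (Fin 2) ℂ) :
    bind₁ N.toMvPolynomial (bind₁ M.toMvPolynomial φ) = φ := by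
  rw [bind₁_bind₁]
  simp_rw [← Matrix.toMvPolynomial_mul, h, Matrix.toMvPolynomial_one]
  exact aeval_X_left_apply φ

theorem eval_bind₁_toMvPolynomial (M : Matrix (Fin 2) (Fin 2) ℂ) (v : Fin 2 → ℂ)
    (φ : MvPolynomial (Fin 2) ℂ) :
    eval v (bind₁ M.toMvPolynomial φ) = eval (M.mulVec v) φ := by
  induction φ using MvPolynomial.induction_on with
  | C a => simp
  | add p q hp hq => simp [hp, hq]
  | mul_X p i hp => simp [hp, Matrix.toMvPolynomial_eval_eq_apply]

theorem MvPolynomial.IsHomogeneous.bind₁_toMvPolynomial {φ : MvPolynomial (Fin 2) ℂ} {n : ℕ}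
    (h : φ.IsHomogeneous n) (M : Matrix (Fin 2) (Fin 2) ℂ) :
    (bind₁ M.toMvPolynomial φ).IsHomogeneous n := by
  simpa using h.aeval M.toMvPolynomial M.toMvPolynomial_isHomogeneous

theorem totalDegree_bind₁_toMvPolynomial_le (M : Matrix (Fin 2) (Fin 2) ℂ)
    (φ : MvPolynomial (Fin 2) ℂ) : (bind₁ M.toMvPolynomial φ).totalDegree ≤ φ.totalDegree := by
  conv_lhs => rw [← sum_homogeneousComponent φ, map_sum]
  exact totalDegree_finsetSum_le fun k hk =>
    ((homogeneousComponent_isHomogeneous k φ).bind₁_toMvPolynomial M).totalDegree_le.trans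
      (Nat.lt_succ_iff.1 (Finset.mem_range.1 hk))

theorem homogeneousComponent_bind₁_toMvPolynomial (M : Matrix (Fin 2) (Fin 2) ℂ)
    (φ : MvPolynomial (Fin 2) ℂ) (n : ℕ) :
    homogeneousComponent n (bind₁ M.toMvPolynomial φ) =
      bind₁ M.toMvPolynomial (homogeneousComponent n φ) := by
  by_cases hn : n ∈ Finset.range (φ.totalDegree + 1)
  · conv_lhs => rw [← sum_homogeneousComponent φ, map_sum, map_sum]
    rw [Finset.sum_eq_single_of_mem n hn fun k _ hk => ?_]
    · exact homogeneousComponent_eq_self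
        ((homogeneousComponent_isHomogeneous n φ).bind₁_toMvPolynomial M)
    · rw [homogeneousComponent_of_mem
        ((homogeneousComponent_isHomogeneous k φ).bind₁_toMvPolynomial M), if_neg hk.symm]
  · have hn' : φ.totalDegree < n := by simpa using hn
    rw [homogeneousComponent_eq_zero n φ hn', map_zero]
    exact homogeneousComponent_eq_zero _ _
      ((totalDegree_bind₁_toMvPolynomial_le M φ).trans_lt hn')

theorem Squarefree.bind₁_toMvPolynomial {φ : MvPolynomial (Fin 2) ℂ} (h : Squarefree φ)
    {M N : Matrix (Fin 2) (Fin 2) ℂ} (hMN : M * N = 1) :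
    Squarefree (bind₁ M.toMvPolynomial φ) := by
  intro u hu
  have h1 := map_dvd (bind₁ N.toMvPolynomial) hu
  rw [bind₁_toMvPolynomial_of_mul_eq_one hMN, map_mul] at h1
  have h2 := (h _ h1).map (bind₁ M.toMvPolynomial)
  rwa [bind₁_toMvPolynomial_of_mul_eq_one (mul_eq_one_comm.1 hMN)] at h2

theorem MvPolynomial.IsHomogeneous.squarefree_aeval_X_one {φ : MvPolynomial (Fin 2) ℂ} {n : ℕ}
    (h : φ.IsHomogeneous n) (hφ : Squarefree φ) :
    Squarefree (MvPolynomial.aeval ![(Polynomial.X : Polynomial ℂ), 1] φ) := by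
  have hhom := Polynomial.homogenize_eq_of_isHomogeneous h rfl
  have hu0 : MvPolynomial.aeval ![(Polynomial.X : Polynomial ℂ), 1] φ ≠ 0 := fun hu => by
    rw [hu, Polynomial.homogenize_zero] at hhom
    exact hφ.ne_zero hhom.symm
  have hdeg : (MvPolynomial.aeval ![(Polynomial.X : Polynomial ℂ), 1] φ).natDegree ≤ n := by
    simpa using h.natDegree_aeval_pair_le (1 : ℂ)
  rintro v ⟨w, hw⟩
  rw [hw] at hu0 hhom hdeg
  have hw0 : w ≠ 0 := right_ne_zero_of_mul hu0
  have hv0 : v ≠ 0 := right_ne_zero_of_mul (left_ne_zero_of_mul hu0)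
  rw [Polynomial.natDegree_mul (mul_ne_zero hv0 hv0) hw0, Polynomial.natDegree_mul hv0 hv0] at hdeg
  obtain ⟨b, rfl⟩ := Nat.exists_eq_add_of_le (le_of_add_le_left hdeg)
  rw [Polynomial.homogenize_mul _ _ (Polynomial.natDegree_mul_le) (by omega),
    Polynomial.homogenize_mul _ _ le_rfl le_rfl] at hhom
  have h1 := (hφ _ ⟨_, hhom.symm⟩).map (MvPolynomial.aeval ![(Polynomial.X : Polynomial ℂ), 1])
  rwa [Polynomial.aeval_homogenize_X_one v le_rfl] at h1

end BinaryForm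

section BivariateCurve

open Polynomial Polynomial.Bivariate Topology Filter

/-- The affine plane curve `P = 0`. -/
def affineCurve (P : ℂ[X][Y]) : Set (ℂ × ℂ) := {z | P.evalEval z.1 z.2 = 0}

/-- The restriction of `P` to the vertical line through `x`. -/
noncomputable def fiberPoly (P : ℂ[X][Y]) (x : ℂ) : ℂ[X] := P.map (Polynomial.evalRingHom x)

/-- The points of the `x`-line over which the curve `P = 0` is unramified. -/
def regularLocus (P : ℂ[X][Y]) : Set ℂ := {x | (fiberPoly P x).Separable}

theorem mem_affineCurve {P : ℂ[X][Y]} {x y : ℂ} :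
    (x, y) ∈ affineCurve P ↔ P.evalEval x y = 0 := Iff.rfl

theorem fiberPoly_eval (P : ℂ[X][Y]) (x y : ℂ) : (fiberPoly P x).eval y = P.evalEval x y :=
  Polynomial.map_evalRingHom_eval x y P

theorem fiberPoly_isRoot {P : ℂ[X][Y]} {x y : ℂ} :
    (fiberPoly P x).IsRoot y ↔ (x, y) ∈ affineCurve P := by
  rw [Polynomial.IsRoot.def, fiberPoly_eval, mem_affineCurve]

theorem evalEval_eq_sum (P : ℂ[X][Y]) (x y : ℂ) :
    P.evalEval x y = ∑ i ∈ Finset.range (P.natDegree + 1), (P.coeff i).eval x * y ^ i := by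
  rw [Polynomial.evalEval, P.eval_eq_sum_range, Polynomial.eval_finsetSum]
  simp

theorem contDiff_evalEval (P : ℂ[X][Y]) : ContDiff ℂ 1 fun z : ℂ × ℂ => P.evalEval z.1 z.2 := by
  simp_rw [evalEval_eq_sum]
  refine ContDiff.sum fun i _ => ContDiff.mul ?_ (contDiff_snd.pow i)
  exact (Polynomial.contDiff_aeval (P.coeff i) 1).comp contDiff_fst

theorem continuous_evalEval (P : ℂ[X][Y]) : Continuous fun z : ℂ × ℂ => P.evalEval z.1 z.2 :=
  (contDiff_evalEval P).continuous

theorem isClosed_affineCurve (P : ℂ[X][Y]) : IsClosed (affineCurve P) :=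
  isClosed_eq (continuous_evalEval P) continuous_const

theorem exists_local_graph {P : ℂ[X][Y]} {z : ℂ × ℂ} (hz : z ∈ affineCurve P)
    (hx : z.1 ∈ regularLocus P) :
    ∃ ψ : ℂ → ℂ, DifferentiableAt ℂ ψ z.1 ∧ ψ z.1 = z.2 ∧
      ∀ᶠ w in 𝓝 z, w ∈ affineCurve P ↔ ψ w.1 = w.2 := by
  have hf := (contDiff_evalEval P).contDiffAt.hasStrictFDerivAt (x := z) one_ne_zero
  set f' := fderiv ℂ (fun z : ℂ × ℂ => P.evalEval z.1 z.2) z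
  have hd : HasDerivAt (fun y => P.evalEval z.1 y) ((f' ∘L .inr ℂ ℂ ℂ) 1) z.2 := by
    have h := hf.hasFDerivAt.comp z.2 (hasFDerivAt_prodMk_right (𝕜 := ℂ) z.1 z.2)
    exact h.hasDerivAt
  have hd' : HasDerivAt (fun y => P.evalEval z.1 y)
      ((fiberPoly P z.1).derivative.eval z.2) z.2 := by
    simp_rw [← fiberPoly_eval]
    exact Polynomial.hasDerivAt _ _
  have hne : (f' ∘L .inr ℂ ℂ ℂ) 1 ≠ 0 := by
    rw [hd.unique hd']
    have h1 : Polynomial.aeval z.2 (fiberPoly P z.1) = 0 := by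
      rw [Polynomial.coe_aeval_eq_eval]
      exact fiberPoly_isRoot.2 hz
    have h2 := Polynomial.Separable.aeval_derivative_ne_zero hx h1
    rwa [Polynomial.coe_aeval_eq_eval] at h2
  have hinv : (f' ∘L .inr ℂ ℂ ℂ).IsInvertible := by
    refine ⟨ContinuousLinearEquiv.unitsEquivAut ℂ (Units.mk0 _ hne), ?_⟩
    ext
    simp
  refine ⟨hf.implicitFunctionOfProdDomain hinv,
    (hf.hasStrictFDerivAt_implicitFunctionOfProdDomain hinv).differentiableAt, ?_, ?_⟩
  · exact (hf.eventually_apply_eq_iff_implicitFunctionOfProdDomain hinv).self_of_nhds.mp rfl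
  · filter_upwards [hf.eventually_apply_eq_iff_implicitFunctionOfProdDomain hinv] with w hw
    rw [← hw]
    have : P.evalEval z.1 z.2 = 0 := hz
    rw [this]
    rfl

theorem eventually_injOn_fst {P : ℂ[X][Y]} {z : ℂ × ℂ} (hz : z ∈ affineCurve P)
    (hx : z.1 ∈ regularLocus P) :
    ∃ U ∈ 𝓝 z, Set.InjOn Prod.fst (U ∩ affineCurve P) := by
  obtain ⟨ψ, -, -, h⟩ := exists_local_graph hz hx
  refine ⟨_, h, ?_⟩
  rintro ⟨a, b⟩ ⟨h1, h2⟩ ⟨a', b'⟩ ⟨h3, h4⟩ (rfl : a = a')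
  have h5 : ψ a = b := h1.1 h2
  have h6 : ψ a = b' := h3.1 h4
  rw [← h5, h6]

theorem fiberPoly_monic {P : ℂ[X][Y]} (hP : P.Monic) (x : ℂ) : (fiberPoly P x).Monic :=
  hP.map _

theorem exists_polynomial_regularLocus {P : ℂ[X][Y]} (hP : P.Monic) :
    ∃ D : ℂ[X], ∀ x, x ∈ regularLocus P ↔ D.eval x ≠ 0 := by
  refine ⟨Polynomial.resultant P P.derivative, fun x => ?_⟩
  have h1 := Polynomial.resultant_map_map P P.derivative P.natDegree P.derivative.natDegree
    (Polynomial.evalRingHom x)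
  rw [Polynomial.coe_evalRingHom] at h1
  have h2 : (P.map (Polynomial.evalRingHom x)).natDegree = P.natDegree := hP.natDegree_map _
  have h3 : (P.derivative.map (Polynomial.evalRingHom x)).natDegree = P.derivative.natDegree := by
    rw [← Polynomial.derivative_map, Polynomial.natDegree_derivative,
      Polynomial.natDegree_derivative, h2]
  have h4 : Polynomial.resultant (P.map (Polynomial.evalRingHom x))
      (P.derivative.map (Polynomial.evalRingHom x)) =
      (Polynomial.resultant P P.derivative).eval x := by
    rw [← h1, h2, h3]
  rw [← h4, Ne, Polynomial.resultant_eq_zero_iff, ← Polynomial.derivative_map]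
  have : P.map (Polynomial.evalRingHom x) ≠ 0 := (fiberPoly_monic hP x).ne_zero
  simp only [this, ne_eq, not_false_eq_true, true_or, true_and, not_not]
  rfl

theorem isOpen_regularLocus {P : ℂ[X][Y]} (hP : P.Monic) : IsOpen (regularLocus P) := by
  obtain ⟨D, hD⟩ := exists_polynomial_regularLocus hP
  have : regularLocus P = {x | D.eval x ≠ 0} := Set.ext hD
  rw [this]
  exact isOpen_ne_fun D.continuous continuous_const

theorem finite_compl_regularLocus {P : ℂ[X][Y]} (hP : P.Monic) (hne : (regularLocus P).Nonempty) :
    (regularLocus P)ᶜ.Finite := by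
  obtain ⟨D, hD⟩ := exists_polynomial_regularLocus hP
  obtain ⟨x, hx⟩ := hne
  have hD0 : D ≠ 0 := by
    rintro rfl
    simp [hD] at hx
  refine (D.rootSet_finite ℂ).subset fun y hy => ?_
  rw [Polynomial.mem_rootSet]
  refine ⟨hD0, ?_⟩
  rw [Polynomial.coe_aeval_eq_eval]
  by_contra h
  exact hy ((hD y).2 h)

theorem exists_continuous_root_bound {P : ℂ[X][Y]} (hP : P.Monic) :
    ∃ b : ℂ → ℝ, Continuous b ∧ ∀ z ∈ affineCurve P, ‖z.2‖ ≤ b z.1 := by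
  refine ⟨fun x => ∑ i ∈ Finset.range P.natDegree, ‖(P.coeff i).eval x‖ + 1, by fun_prop, ?_⟩
  rintro ⟨x, y⟩ hz
  have hm := fiberPoly_monic hP x
  have h := (Polynomial.IsRoot.norm_lt_cauchyBound hm.ne_zero (fiberPoly_isRoot.2 hz)).le
  have hdeg : (fiberPoly P x).natDegree = P.natDegree := hP.natDegree_map _
  have h' : (fiberPoly P x).cauchyBound ≤
      ∑ i ∈ Finset.range P.natDegree, ‖(P.coeff i).eval x‖₊ + 1 := by
    rw [Polynomial.cauchyBound, hm.leadingCoeff, nnnorm_one, div_one, hdeg]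
    gcongr
    refine Finset.sup_le fun i hi => ?_
    have : ‖(fiberPoly P x).coeff i‖₊ = ‖(P.coeff i).eval x‖₊ := by simp [fiberPoly]
    rw [this]
    exact Finset.single_le_sum (f := fun i => ‖(P.coeff i).eval x‖₊) (fun _ _ => zero_le) hi
  have := NNReal.coe_le_coe.2 (h.trans h')
  push_cast at this
  exact this

theorem isProperMap_fst_affineCurve {P : ℂ[X][Y]} (hP : P.Monic) :
    IsProperMap fun z : affineCurve P => z.1.1 := by
  obtain ⟨b, hb, hbP⟩ := exists_continuous_root_bound hP
  rw [isProperMap_iff_isCompact_preimage]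
  refine ⟨by fun_prop, fun K hK => ?_⟩
  rw [Subtype.isCompact_iff]
  obtain ⟨M, hM⟩ := hK.bddAbove_image hb.continuousOn
  have hcl : IsClosed (affineCurve P ∩ Prod.fst ⁻¹' K) :=
    (isClosed_affineCurve P).inter (hK.isClosed.preimage continuous_fst)
  refine (hK.prod (isCompact_closedBall (0 : ℂ) M)).of_isClosed_subset (s := _) ?_ ?_
  · convert hcl using 1
    ext z
    simp [and_comm]
  · rintro _ ⟨⟨z, hz⟩, hzK, rfl⟩
    refine ⟨hzK, ?_⟩
    rw [mem_closedBall_zero_iff]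
    exact (hbP z hz).trans (hM ⟨_, hzK, rfl⟩)

theorem isLocalHomeomorphOn_fst_affineCurve {P : ℂ[X][Y]} (hP : P.Monic) :
    IsLocalHomeomorphOn (fun z : affineCurve P => z.1.1)
      ((fun z : affineCurve P => z.1.1) ⁻¹' regularLocus P) := by
  rw [isLocalHomeomorphOn_iff_isOpenEmbedding_restrict]
  rintro z hz
  obtain ⟨U, hU, hinj⟩ := eventually_injOn_fst z.2 hz
  obtain ⟨V, hVU, hVo, hzV⟩ := mem_nhds_iff.1 hU
  let W : Set (affineCurve P) := Subtype.val ⁻¹' (V ∩ Prod.fst ⁻¹' regularLocus P)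
  have hWo : IsOpen W := (hVo.inter ((isOpen_regularLocus hP).preimage continuous_fst)).preimage
    continuous_subtype_val
  refine ⟨W, hWo.mem_nhds ⟨hzV, hz⟩, ?_⟩
  refine IsOpenEmbedding.of_continuous_injective_isOpenMap ?_ ?_ ?_
  · exact (by fun_prop : Continuous fun z : affineCurve P => z.1.1).comp continuous_subtype_val
  · rintro ⟨a, ha⟩ ⟨b, hb⟩ hab
    exact Subtype.ext (Subtype.ext (hinj ⟨hVU ha.1, a.2⟩ ⟨hVU hb.1, b.2⟩ hab))
  · rw [isOpenMap_iff_nhds_le]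
    rintro ⟨a, ha⟩
    obtain ⟨ψ, hψd, hψ, hψe⟩ := exists_local_graph a.2 ha.2
    have ht : Tendsto (fun x => (x, ψ x)) (𝓝 a.1.1) (𝓝 a.1) := by
      have := tendsto_id.prodMk_nhds hψd.continuousAt.tendsto
      rwa [hψ] at this
    have hcurve : ∀ᶠ x in 𝓝 a.1.1, (x, ψ x) ∈ affineCurve P :=
      (ht.eventually hψe).mono fun x hx => hx.2 rfl
    intro s hs
    rw [mem_map, mem_nhds_subtype] at hs
    obtain ⟨t, ht1, ht2⟩ := hs
    rw [mem_nhds_subtype] at ht1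
    obtain ⟨t', ht1', ht2'⟩ := ht1
    have hV' : V ∩ Prod.fst ⁻¹' regularLocus P ∈ 𝓝 a.1 :=
      (hVo.inter ((isOpen_regularLocus hP).preimage continuous_fst)).mem_nhds ha
    filter_upwards [hcurve, ht.eventually hV', ht.eventually ht1'] with x h1 h2 h3
    exact ht2 (a := ⟨⟨(x, ψ x), h1⟩, h2⟩) (ht2' h3)

theorem isCoveringMapOn_fst_affineCurve {P : ℂ[X][Y]} (hP : P.Monic) :
    IsCoveringMapOn (fun z : affineCurve P => z.1.1) (regularLocus P) := by
  refine (isProperMap_fst_affineCurve hP).isClosedMap.isCoveringMapOn_of_isLocalHomeomorphOn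
    (fun x _ => ?_) (isLocalHomeomorphOn_fst_affineCurve hP)
  refine Set.Finite.of_finite_image (f := fun z : affineCurve P => z.1.2) ?_ ?_
  · refine ((fiberPoly P x).rootSet_finite ℂ).subset ?_
    rintro _ ⟨z, rfl, rfl⟩
    rw [Polynomial.mem_rootSet, Polynomial.coe_aeval_eq_eval]
    exact ⟨(fiberPoly_monic hP _).ne_zero, fiberPoly_isRoot.2 z.2⟩
  · intro z hz w hw h
    exact Subtype.ext (Prod.ext (hz.trans hw.symm) h)

/-- `r` is a continuous section over `T` of the projection of the curve `P = 0`. -/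
def IsSectionOn (P : ℂ[X][Y]) (r : ℂ → ℂ) (T : Set ℂ) : Prop :=
  ContinuousOn r T ∧ ∀ t ∈ T, (t, r t) ∈ affineCurve P

theorem IsSectionOn.mono {P : ℂ[X][Y]} {r : ℂ → ℂ} {S T : Set ℂ} (h : IsSectionOn P r T)
    (hST : S ⊆ T) : IsSectionOn P r S :=
  ⟨h.1.mono hST, fun t ht => h.2 t (hST ht)⟩

theorem exists_isSectionOn {P : ℂ[X][Y]} (hP : P.Monic) {T : Set ℂ} (hT : Convex ℝ T)
    (hTr : T ⊆ regularLocus P) {x y : ℂ} (hx : x ∈ T) (hy : (x, y) ∈ affineCurve P) :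
    ∃ r, IsSectionOn P r T ∧ r x = y := by
  classical
  have : ContractibleSpace T := hT.contractibleSpace ⟨x, hx⟩
  have : LocallyPathConnectedSpace T := hT.locallyPathConnectedSpace
  obtain ⟨F, ⟨hF1, hF2⟩, -⟩ :=
    (isCoveringMapOn_fst_affineCurve hP).existsUnique_continuousMap_lifts
      (⟨Subtype.val, continuous_subtype_val⟩ : C(T, ℂ)) (a₀ := ⟨x, hx⟩) (e₀ := ⟨(x, y), hy⟩) rfl
      (fun a => hTr a.2)
  have hF3 : ∀ t, (F t).1.1 = t.1 := fun t => congr_fun hF2 t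
  refine ⟨fun t => if h : t ∈ T then (F ⟨t, h⟩).1.2 else 0, ⟨?_, fun t ht => ?_⟩, ?_⟩
  · rw [continuousOn_iff_continuous_domRestrict]
    have : T.domRestrict (fun t => if h : t ∈ T then (F ⟨t, h⟩).1.2 else 0) =
        fun t => (F t).1.2 := by
      ext t
      simp [t.2]
    rw [this]
    fun_prop
  · have h := (F ⟨t, ht⟩).2
    have h' := hF3 ⟨t, ht⟩
    simp only [ht, dite_true]
    convert h using 1
    exact Prod.ext h'.symm rfl
  · simp [hx, hF1]

theorem IsSectionOn.eqOn {P : ℂ[X][Y]} {T : Set ℂ} (hT : IsPreconnected T)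
    (hTr : T ⊆ regularLocus P) {r s : ℂ → ℂ} (hr : IsSectionOn P r T) (hs : IsSectionOn P s T)
    {x : ℂ} (hx : x ∈ T) (h : r x = s x) : Set.EqOn r s T := by
  have : PreconnectedSpace T := isPreconnected_iff_preconnectedSpace.1 hT
  have hr1 : Continuous (fun t : T => r t) := hr.1.domRestrict
  have hs1 : Continuous (fun t : T => s t) := hs.1.domRestrict
  have hcl : IsClopen {t : T | r t = s t} := by
    refine ⟨isClosed_eq hr1 hs1, ?_⟩
    rw [isOpen_iff_mem_nhds]
    intro t (ht : r t = s t)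
    obtain ⟨U, hU, hinj⟩ := eventually_injOn_fst (hr.2 t t.2) (hTr t.2)
    have h1 : Tendsto (fun t : T => ((t : ℂ), r t)) (𝓝 t) (𝓝 ((t : ℂ), r t)) :=
      (continuous_subtype_val.prodMk hr1).continuousAt
    have h2 : Tendsto (fun t : T => ((t : ℂ), s t)) (𝓝 t) (𝓝 ((t : ℂ), r t)) := by
      rw [ht]
      exact (continuous_subtype_val.prodMk hs1).continuousAt
    filter_upwards [h1.eventually hU, h2.eventually hU] with t' h1 h2
    exact congr_arg Prod.snd (hinj ⟨h1, hr.2 t' t'.2⟩ ⟨h2, hs.2 t' t'.2⟩ rfl)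
  have huniv := hcl.eq_univ ⟨⟨x, hx⟩, h⟩
  intro t ht
  exact (Set.ext_iff.1 huniv ⟨t, ht⟩).2 trivial

theorem IsSectionOn.isClosed_graph {P : ℂ[X][Y]} {T : Set ℂ} (hTc : IsClosed T) {r : ℂ → ℂ}
    (hr : IsSectionOn P r T) : IsClosed {z : affineCurve P | z.1.1 ∈ T ∧ z.1.2 = r z.1.1} := by
  have hT' : IsClosed {z : affineCurve P | z.1.1 ∈ T} := hTc.preimage (by fun_prop)
  have hc : ContinuousOn (fun z : affineCurve P => z.1.2 - r z.1.1)
      {z : affineCurve P | z.1.1 ∈ T} :=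
    ContinuousOn.sub (by fun_prop) (hr.1.comp (by fun_prop) fun z hz => hz)
  have := hc.preimage_isClosed_of_isClosed hT' (isClosed_singleton (x := (0 : ℂ)))
  convert this using 1
  ext z
  simp [sub_eq_zero]

theorem IsSectionOn.isClosed_compl_graph {P : ℂ[X][Y]} {T : Set ℂ} (hTc : IsClosed T)
    (hTr : T ⊆ regularLocus P) {r : ℂ → ℂ} (hr : IsSectionOn P r T) :
    IsClosed {z : affineCurve P | z.1.1 ∈ T ∧ z.1.2 ≠ r z.1.1} := by
  have hT' : IsClosed {z : affineCurve P | z.1.1 ∈ T} := hTc.preimage (by fun_prop)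
  rw [← isOpen_compl_iff, isOpen_iff_mem_nhds]
  intro z hz
  by_cases hzT : z.1.1 ∈ T
  · have hzr : z.1.2 = r z.1.1 := by
      by_contra h
      exact hz ⟨hzT, h⟩
    obtain ⟨U, hU, hinj⟩ := eventually_injOn_fst z.2 (hTr hzT)
    have h1 : Tendsto (fun w : affineCurve P => (w.1.1, r w.1.1))
        (𝓝[{z : affineCurve P | z.1.1 ∈ T}] z) (𝓝 (z.1.1, r z.1.1)) := by
      have h2 : ContinuousOn (fun w : affineCurve P => (w.1.1, r w.1.1))
        {z : affineCurve P | z.1.1 ∈ T} :=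
        ContinuousOn.prodMk (by fun_prop) (hr.1.comp (by fun_prop) fun z hz => hz)
      exact h2 z hzT
    have hz' : (z.1.1, r z.1.1) = z.1 := Prod.ext rfl hzr.symm
    rw [hz'] at h1
    have h3 := h1.eventually hU
    rw [eventually_nhdsWithin_iff] at h3
    have h4 : ∀ᶠ w : affineCurve P in 𝓝 z, w.1 ∈ U := continuous_subtype_val.continuousAt hU
    filter_upwards [h3, h4] with w h5 h6 h7
    exact h7.2 (congr_arg Prod.snd (hinj ⟨h6, w.2⟩ ⟨h5 h7.1, hr.2 _ h7.1⟩ rfl))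
  · filter_upwards [hT'.isOpen_compl.mem_nhds hzT] with w hw h
    exact hw h.1

theorem Polynomial.Monic.eq_prod_X_sub_C {R ι : Type*} [CommRing R] [IsDomain R] {p : R[X]}
    (hp : p.Monic) {s : Finset ι} {v : ι → R} (hv : Set.InjOn v s) (hd : p.natDegree = s.card)
    (hr : ∀ i ∈ s, p.eval (v i) = 0) : p = ∏ i ∈ s, (Polynomial.X - Polynomial.C (v i)) := by
  have hm : (∏ i ∈ s, (Polynomial.X - Polynomial.C (v i))).Monic :=
    Polynomial.monic_prod_X_sub_C v s
  refine Polynomial.eq_of_degree_sub_lt_of_eval_index_eq s hv ?_ fun i hi => ?_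
  · have hdp : p.degree = (s.card : WithBot ℕ) := by
      rw [Polynomial.degree_eq_natDegree hp.ne_zero, hd]
    have hdq : (∏ i ∈ s, (Polynomial.X - Polynomial.C (v i))).degree = (s.card : WithBot ℕ) := by
      rw [Polynomial.degree_eq_natDegree hm.ne_zero,
        Polynomial.natDegree_finsetProd_X_sub_C_eq_card]
    rw [← hdp]
    exact Polynomial.degree_sub_lt_left (hdp.trans hdq.symm) hp.ne_zero
      (hp.leadingCoeff.trans hm.leadingCoeff.symm)
  · rw [hr i hi, Polynomial.eval_prod, Finset.prod_eq_zero hi]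
    simp

/-- A family of sections of the curve `P = 0` over `{x | R < ‖x‖}`, one for each asymptotic
slope `l ∈ Λ`, exhausting the curve over that set. -/
structure AsymptoticSections (P : ℂ[X][Y]) (Λ : Finset ℂ) (R : ℝ) (s : ℂ → ℂ → ℂ) : Prop where
  monic : P.Monic
  natDegree_eq : P.natDegree = Λ.card
  pos : 0 < R
  isSectionOn : ∀ l ∈ Λ, IsSectionOn P (s l) {x | R < ‖x‖}
  injOn : ∀ x, R < ‖x‖ → Set.InjOn (fun l => s l x) Λ
  tendsto : ∀ l ∈ Λ, Tendsto (fun x => s l x / x) (cocompact ℂ) (𝓝 l)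

theorem AsymptoticSections.subset_regularLocus {P : ℂ[X][Y]} {Λ : Finset ℂ} {R : ℝ}
    {s : ℂ → ℂ → ℂ} (h : AsymptoticSections P Λ R s) : {x | R < ‖x‖} ⊆ regularLocus P := by
  intro x hx
  have h1 : fiberPoly P x = ∏ l ∈ Λ, (Polynomial.X - Polynomial.C (s l x)) := by
    refine (fiberPoly_monic h.monic x).eq_prod_X_sub_C (h.injOn x hx) ?_ fun l hl => ?_
    · rw [← h.natDegree_eq]
      exact h.monic.natDegree_map _
    · rw [fiberPoly_eval]
      exact (h.isSectionOn l hl).2 x hx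
  change (fiberPoly P x).Separable
  rw [h1, Polynomial.separable_prod_X_sub_C_iff']
  exact fun a ha b hb hab => h.injOn x hx ha hb hab

theorem exists_asymptoticSections {P Q : ℂ[X][Y]} (hP : P.Monic) (hQ : Q.Monic)
    (hdeg : P.natDegree = Q.natDegree)
    (hPQ : ∀ x y : ℂ, x ≠ 0 →
      P.evalEval x y = x ^ Q.natDegree * Q.evalEval x⁻¹ (x⁻¹ * y))
    (h0 : (fiberPoly Q 0).Separable) :
    ∃ Λ R s, AsymptoticSections P Λ R s := by
  classical
  let Λ : Finset ℂ := (fiberPoly Q 0).roots.toFinset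
  have hΛ : ∀ l ∈ Λ, (0, l) ∈ affineCurve Q := by
    intro l hl
    rw [Multiset.mem_toFinset, Polynomial.mem_roots (fiberPoly_monic hQ 0).ne_zero] at hl
    exact fiberPoly_isRoot.1 hl
  have hcard : Λ.card = Q.natDegree := by
    rw [Multiset.toFinset_card_of_nodup (Polynomial.nodup_roots h0),
      IsAlgClosed.card_roots_eq_natDegree]
    exact hQ.natDegree_map _
  obtain ⟨ε, hε, hεQ⟩ := Metric.isOpen_iff.1 (isOpen_regularLocus hQ) 0 h0
  have hm : ∀ l : ℂ, ∃ m : ℂ → ℂ, l ∈ Λ → IsSectionOn Q m (Metric.ball 0 ε) ∧ m 0 = l := by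
    intro l
    by_cases hl : l ∈ Λ
    · obtain ⟨m, hm⟩ := exists_isSectionOn hQ (convex_ball 0 ε) hεQ (Metric.mem_ball_self hε)
        (hΛ l hl)
      exact ⟨m, fun _ => hm⟩
    · exact ⟨0, fun h => absurd h hl⟩
  choose m hm using hm
  have hinv : ∀ x : ℂ, ε⁻¹ < ‖x‖ → x ≠ 0 ∧ x⁻¹ ∈ Metric.ball (0 : ℂ) ε := by
    intro x hx
    refine ⟨norm_pos_iff.1 ((inv_pos.2 hε).trans hx), ?_⟩
    rw [mem_ball_zero_iff, norm_inv]
    exact inv_lt_of_inv_lt₀ hε hx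
  refine ⟨Λ, ε⁻¹, fun l x => x * m l x⁻¹, hP, by rw [hdeg, hcard], inv_pos.2 hε, ?_, ?_, ?_⟩
  · intro l hl
    refine ⟨?_, fun x hx => ?_⟩
    · refine continuousOn_id.mul ((hm l hl).1.1.comp ?_ fun x hx => (hinv x hx).2)
      exact continuousOn_inv₀.mono fun x hx => (hinv x hx).1
    · obtain ⟨h1, h2⟩ := hinv x hx
      have h3 : Q.evalEval x⁻¹ (m l x⁻¹) = 0 := (hm l hl).1.2 _ h2
      rw [mem_affineCurve, hPQ x _ h1, inv_mul_cancel_left₀ h1, h3, mul_zero]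
  · intro x hx l hl l' hl' h
    obtain ⟨h1, h2⟩ := hinv x hx
    have h3 := mul_left_cancel₀ h1 h
    have h4 := (hm l hl).1.eqOn (convex_ball _ _).isPreconnected hεQ (hm l' hl').1 h2 h3
      (Metric.mem_ball_self hε)
    rwa [(hm l hl).2, (hm l' hl').2] at h4
  · intro l hl
    have h1 : Tendsto (fun x : ℂ => m l x⁻¹) (cocompact ℂ) (𝓝 (m l 0)) := by
      refine Tendsto.comp ?_ (tendsto_inv₀_cobounded (α := ℂ) |>.mono_left ?_)
      · exact ((hm l hl).1.1.continuousAt (Metric.ball_mem_nhds 0 hε))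
      · rw [Metric.cobounded_eq_cocompact]
    rw [(hm l hl).2] at h1
    refine h1.congr' ?_
    have : ∀ᶠ x : ℂ in cocompact ℂ, x ≠ 0 := by
      have := (isCompact_singleton (x := (0 : ℂ))).compl_mem_cocompact
      exact this
    filter_upwards [this] with x hx
    rw [mul_div_cancel_left₀ _ hx]

/-- The closed half-line issuing from `x` in the direction `u`. -/
def ray (x u : ℂ) : Set ℂ := (fun t : ℝ => x + t * u) '' Set.Ici 0

theorem self_mem_ray (x u : ℂ) : x ∈ ray x u := ⟨0, Set.self_mem_Ici, by simp⟩

theorem add_mul_mem_ray (x u : ℂ) {t : ℝ} (ht : 0 ≤ t) : x + t * u ∈ ray x u := ⟨t, ht, rfl⟩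

theorem convex_ray (x u : ℂ) : Convex ℝ (ray x u) := by
  rintro _ ⟨a, ha, rfl⟩ _ ⟨b, hb, rfl⟩ p q hp hq hpq
  refine ⟨p * a + q * b, add_nonneg (mul_nonneg hp ha) (mul_nonneg hq hb), ?_⟩
  have : (p : ℂ) + q = 1 := by exact_mod_cast hpq
  simp only [Complex.real_smul, Complex.ofReal_add, Complex.ofReal_mul]
  linear_combination -x * this

theorem isClosed_ray (x : ℂ) {u : ℂ} (hu : u ≠ 0) : IsClosed (ray x u) := by
  have hc : Topology.IsClosedEmbedding fun t : ℝ => x + t * u := by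
    refine (Homeomorph.addLeft x).isClosedEmbedding.comp ?_
    simpa only [Complex.real_smul] using isClosedEmbedding_smul_left (𝕜 := ℝ) hu
  exact hc.isClosedMap _ isClosed_Ici

theorem ray_add_mul_subset (x u : ℂ) {t : ℝ} (ht : 0 ≤ t) : ray (x + t * u) u ⊆ ray x u := by
  rintro _ ⟨a, ha, rfl⟩
  exact ⟨t + a, add_nonneg ht ha, by push_cast; ring⟩

theorem tendsto_norm_add_mul_atTop (x : ℂ) {u : ℂ} (hu : u ≠ 0) :
    Tendsto (fun t : ℝ => ‖x + t * u‖) atTop atTop := by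
  have h1 : Tendsto (fun t : ℝ => t * ‖u‖ - ‖x‖) atTop atTop :=
    tendsto_atTop_add_const_right _ _ (tendsto_id.atTop_mul_const (norm_pos_iff.2 hu))
  refine tendsto_atTop_mono (fun t => ?_) h1
  have h2 : ‖(t : ℂ) * u‖ ≤ ‖x + t * u‖ + ‖x‖ := by
    calc ‖(t : ℂ) * u‖ = ‖(x + t * u) - x‖ := by ring_nf
      _ ≤ _ := norm_sub_le _ _
  rw [norm_mul, Complex.norm_real, Real.norm_eq_abs] at h2
  nlinarith [le_abs_self t, norm_nonneg u, norm_nonneg x]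

/-- Continuing the section `s l` from infinity along the half-line from `x` in the direction `u`
yields the value `v` at `x`. -/
def ContinuesTo (P : ℂ[X][Y]) (s : ℂ → ℂ → ℂ) (l x u v : ℂ) : Prop :=
  u ≠ 0 ∧ ray x u ⊆ regularLocus P ∧ ∃ r, IsSectionOn P r (ray x u) ∧ r x = v ∧
    ∀ᶠ t : ℝ in atTop, r (x + t * u) = s l (x + t * u)

theorem AsymptoticSections.finite_compl_regularLocus {P : ℂ[X][Y]} {Λ : Finset ℂ} {R : ℝ}
    {s : ℂ → ℂ → ℂ} (h : AsymptoticSections P Λ R s) : (regularLocus P)ᶜ.Finite := by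
  refine _root_.finite_compl_regularLocus h.monic ⟨((R + 1 : ℝ) : ℂ), h.subset_regularLocus ?_⟩
  have := h.pos
  rw [Set.mem_ofPred_eq, Complex.norm_real, Real.norm_eq_abs, abs_of_pos (by linarith)]
  linarith

theorem AsymptoticSections.exists_continuesTo {P : ℂ[X][Y]} {Λ : Finset ℂ} {R : ℝ}
    {s : ℂ → ℂ → ℂ} (h : AsymptoticSections P Λ R s) {l : ℂ} (hl : l ∈ Λ) {x u : ℂ} (hu : u ≠ 0)
    (hray : ray x u ⊆ regularLocus P) :
    ∃ ε > 0, ∃ r, IsSectionOn P r (Metric.ball x ε) ∧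
      ∀ y ∈ Metric.ball x ε, ContinuesTo P s l y u (r y) := by
  obtain ⟨ε, hε, hdisj⟩ := Disjoint.exists_thickenings
    (Set.disjoint_compl_left_iff_subset.2 hray) h.finite_compl_regularLocus.isCompact
    (isClosed_ray x hu)
  have hTr : Metric.thickening ε (ray x u) ⊆ regularLocus P := by
    rw [← Set.disjoint_compl_left_iff_subset]
    exact hdisj.mono_left (Metric.self_subset_thickening hε _)
  obtain ⟨N, hN⟩ := eventually_atTop.1
    ((tendsto_norm_add_mul_atTop x hu).eventually_gt_atTop (R + ε))
  set M := max N 0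
  set p := x + M * u
  have hM0 : 0 ≤ M := le_max_right _ _
  have hpfar : Metric.thickening ε (ray p u) ⊆ {x | R < ‖x‖} := by
    intro y hy
    obtain ⟨_, ⟨t, ht, rfl⟩, hty⟩ := Metric.mem_thickening_iff.1 hy
    have h1 := hN (M + t) ((le_max_left _ _).trans (le_add_of_nonneg_right ht))
    have h2 : x + ((M + t : ℝ) : ℂ) * u = p + t * u := by push_cast; ring
    rw [h2] at h1
    have h3 : ‖p + t * u‖ ≤ ‖y‖ + dist y (p + t * u) := by
      rw [dist_eq_norm, norm_sub_rev]
      exact norm_le_norm_add_norm_sub' _ _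
    change R < ‖y‖
    linarith
  have hsub : Metric.thickening ε (ray p u) ⊆ Metric.thickening ε (ray x u) :=
    Metric.thickening_subset_of_subset _ (ray_add_mul_subset x u hM0)
  have hpmem : p ∈ Metric.thickening ε (ray p u) :=
    Metric.self_subset_thickening hε _ (self_mem_ray _ _)
  obtain ⟨r, hr, hrp⟩ := exists_isSectionOn h.monic ((convex_ray x u).thickening ε) hTr
    (hsub hpmem) ((h.isSectionOn l hl).2 p (hpfar hpmem))
  have hrs : Set.EqOn r (s l) (Metric.thickening ε (ray p u)) :=
    (hr.mono hsub).eqOn ((convex_ray p u).thickening ε).isPreconnected (hsub.trans hTr)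
      ((h.isSectionOn l hl).mono hpfar) hpmem hrp
  have hmem : ∀ y ∈ Metric.ball x ε, ∀ t : ℝ, dist (y + t * u) (x + t * u) < ε := by
    intro y hy t
    rw [dist_add_right]
    exact hy
  have hball : ∀ y ∈ Metric.ball x ε, ray y u ⊆ Metric.thickening ε (ray x u) := by
    rintro y hy _ ⟨t, ht, rfl⟩
    exact Metric.mem_thickening_iff.2 ⟨_, add_mul_mem_ray x u ht, hmem y hy t⟩
  refine ⟨ε, hε, r, hr.mono fun y hy => hball y hy (self_mem_ray _ _), fun y hy =>
    ⟨hu, (hball y hy).trans hTr, r, hr.mono (hball y hy), rfl, ?_⟩⟩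
  filter_upwards [eventually_ge_atTop M] with t ht
  refine hrs (Metric.mem_thickening_iff.2 ⟨_, add_mul_mem_ray p u (sub_nonneg.2 ht), ?_⟩)
  have : p + ((t - M : ℝ) : ℂ) * u = x + t * u := by simp only [p]; push_cast; ring
  rw [this]
  exact hmem y hy t

/-- The signed area of the parallelogram spanned by two complex numbers. -/
def crossProd (u v : ℂ) : ℝ := u.re * v.im - u.im * v.re

theorem exists_real_coordinates {u v : ℂ} (huv : crossProd u v ≠ 0) (x : ℂ) :
    ∃ a b : ℂ → ℝ, Continuous a ∧ Continuous b ∧ (∀ t, t = x + a t * u + b t * v) ∧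
      ∀ p q : ℝ, a (x + p * u + q * v) = p ∧ b (x + p * u + q * v) = q := by
  obtain ⟨D, hD⟩ : ∃ D, D = u.re * v.im - u.im * v.re := ⟨_, rfl⟩
  rw [crossProd, ← hD] at huv
  refine ⟨fun t => ((t - x).re * v.im - (t - x).im * v.re) / D,
    fun t => (u.re * (t - x).im - u.im * (t - x).re) / D,
    by fun_prop, by fun_prop, fun t => ?_, fun p q => ⟨?_, ?_⟩⟩
  · apply Complex.ext <;>
    · simp only [Complex.add_re, Complex.add_im, Complex.re_ofReal_mul, Complex.im_ofReal_mul,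
        Complex.sub_re, Complex.sub_im]
      field_simp
      rw [hD]
      ring
  all_goals
    simp only [Complex.add_re, Complex.add_im, Complex.re_ofReal_mul, Complex.im_ofReal_mul,
      Complex.sub_re, Complex.sub_im]
    rw [div_eq_iff huv, hD]
    ring

theorem exists_crossProd_ne_zero {S : Set ℂ} (hS : S.Finite) :
    ∃ w : ℂ, w ≠ 0 ∧ ∀ z ∈ S, z ≠ 0 → crossProd z w ≠ 0 := by
  obtain ⟨t, ht⟩ := (hS.image fun z : ℂ => z.im / z.re).exists_notMem
  refine ⟨⟨1, t⟩, fun h => by simpa using congr_arg Complex.re h, fun z hz hz0 h => ?_⟩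
  simp only [crossProd, mul_one] at h
  by_cases hre : z.re = 0
  · exact hz0 (Complex.ext hre (by simpa [hre] using h))
  · exact ht ⟨z, hz, by rw [div_eq_iff hre]; linarith⟩

theorem AsymptoticSections.exists_good_direction {P : ℂ[X][Y]} {Λ : Finset ℂ} {R : ℝ}
    {s : ℂ → ℂ → ℂ} (h : AsymptoticSections P Λ R s) {x : ℂ} (hx : x ∈ regularLocus P) {S : Set ℂ}
    (hS : S.Finite) :
    ∃ w : ℂ, w ≠ 0 ∧ ray x w ⊆ regularLocus P ∧ ∀ z ∈ S, z ≠ 0 → crossProd z w ≠ 0 := by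
  obtain ⟨w, hw0, hw⟩ := exists_crossProd_ne_zero
    (hS.union (h.finite_compl_regularLocus.image fun b => b - x))
  refine ⟨w, hw0, ?_, fun z hz => hw z (Or.inl hz)⟩
  rintro _ ⟨t, ht, rfl⟩
  by_contra hb
  refine hw _ (Or.inr ⟨_, hb, rfl⟩) (fun h0 => hb ?_) ?_
  · simp only [sub_eq_zero] at h0
    simpa only [h0] using hx
  · simp only [crossProd, add_sub_cancel_left, Complex.mul_re, Complex.mul_im, Complex.ofReal_re,
      Complex.ofReal_im]
    ring

theorem eventually_lt_norm_of_isCompact {K : Set ℂ} (hK : IsCompact K) (h0 : 0 ∉ K) (x : ℂ)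
    (R : ℝ) : ∀ᶠ N : ℝ in atTop, ∀ k ∈ K, R < ‖x + N * k‖ := by
  rcases K.eq_empty_or_nonempty with rfl | hne
  · simp
  obtain ⟨k₀, hk₀, hmin⟩ := hK.exists_isMinOn hne continuous_norm.continuousOn
  have hpos : 0 < ‖k₀‖ := norm_pos_iff.2 fun h => h0 (h ▸ hk₀)
  filter_upwards [eventually_gt_atTop ((R + ‖x‖) / ‖k₀‖), eventually_ge_atTop 0] with N hN hN0 k hk
  have h1 : ‖(N : ℂ) * k‖ ≤ ‖x + N * k‖ + ‖x‖ := by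
    calc ‖(N : ℂ) * k‖ = ‖(x + N * k) - x‖ := by ring_nf
      _ ≤ _ := norm_sub_le _ _
  rw [norm_mul, Complex.norm_real, Real.norm_eq_abs, abs_of_nonneg hN0] at h1
  rw [div_lt_iff₀ hpos] at hN
  have h2 : ‖k₀‖ ≤ ‖k‖ := hmin hk
  nlinarith

theorem AsymptoticSections.isPreconnected_preimage {P : ℂ[X][Y]} {Λ : Finset ℂ} {R : ℝ}
    {s : ℂ → ℂ → ℂ} (h : AsymptoticSections P Λ R s) {l : ℂ} (hl : l ∈ Λ) {T : Set ℂ}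
    (hT : IsPreconnected T) (hTR : T ⊆ {x | R < ‖x‖}) :
    IsPreconnected {z : affineCurve P | z.1.1 ∈ T ∧ z.1.2 = s l z.1.1} := by
  rw [← Topology.IsInducing.subtypeVal.isPreconnected_image]
  have : Subtype.val '' {z : affineCurve P | z.1.1 ∈ T ∧ z.1.2 = s l z.1.1} =
      (fun t => (t, s l t)) '' T := by
    ext z
    constructor
    · rintro ⟨z, ⟨h1, h2⟩, rfl⟩
      exact ⟨z.1.1, h1, Prod.ext rfl h2.symm⟩
    · rintro ⟨t, ht, rfl⟩
      exact ⟨⟨(t, s l t), (h.isSectionOn l hl).2 t (hTR ht)⟩, ⟨ht, rfl⟩, rfl⟩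
  rw [this]
  exact hT.image _ (continuousOn_id.prodMk ((h.isSectionOn l hl).1.mono hTR))

theorem AsymptoticSections.continuesTo_unique_of_crossProd {P : ℂ[X][Y]} {Λ : Finset ℂ} {R : ℝ}
    {s : ℂ → ℂ → ℂ} (h : AsymptoticSections P Λ R s) [ContractibleSpace (affineCurve P)] {l : ℂ}
    (hl : l ∈ Λ) {x u u' v v' : ℂ} (huv : crossProd u u' ≠ 0) (hv : ContinuesTo P s l x u v)
    (hv' : ContinuesTo P s l x u' v') : v = v' := by
  by_contra hne
  obtain ⟨hu, hray, r, hr, hrx, hrs⟩ := hv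
  obtain ⟨hu', hray', r', hr', hrx', hrs'⟩ := hv'
  obtain ⟨q, hq, hqx⟩ := exists_isSectionOn h.monic (convex_ray x u') hray' (self_mem_ray x u')
    (hr.2 x (self_mem_ray x u))
  have hqr' : ∀ t ∈ ray x u', q t ≠ r' t := fun t ht hqt => by
    have := hq.eqOn (convex_ray x u').isPreconnected hray' hr' ht hqt (self_mem_ray x u')
    rw [hqx, hrx, hrx'] at this
    exact hne this
  obtain ⟨a, b, ha, hb, hab, hab'⟩ := exists_real_coordinates huv x
  have hind : ∀ p q : ℝ, (p : ℂ) * u + q * u' = 0 → p = 0 ∧ q = 0 := by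
    intro p q hpq
    have h1 := hab' p q
    have h2 := hab' 0 0
    rw [add_assoc, hpq] at h1
    simp only [Complex.ofReal_zero, zero_mul, add_zero] at h1 h2
    exact ⟨h1.1.symm.trans h2.1, h1.2.symm.trans h2.2⟩
  have hseg : ∀ e e' : ℝ, e ≠ 0 → e' ≠ 0 → (0 : ℂ) ∉ segment ℝ ((e : ℂ) * u) (e' * u') := by
    rintro e e' he he' ⟨p, q, hp, hq, hpq, h0⟩
    simp only [Complex.real_smul, ← mul_assoc, ← Complex.ofReal_mul] at h0
    obtain ⟨h1, h2⟩ := hind _ _ h0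
    simp only [mul_eq_zero, he, he', or_false] at h1 h2
    rw [h1, h2] at hpq
    norm_num at hpq
  have hcpt : ∀ e e' : ℝ, IsCompact (segment ℝ ((e : ℂ) * u) (e' * u')) := by
    intro e e'
    rw [segment_eq_image_lineMap]
    exact isCompact_Icc.image AffineMap.lineMap_continuous
  have hfar : ∀ e e' : ℝ, e ≠ 0 → e' ≠ 0 → ∀ᶠ N : ℝ in atTop,
      (fun k => x + N * k) '' segment ℝ ((e : ℂ) * u) (e' * u') ⊆ {x | R < ‖x‖} := by
    intro e e' he he'
    filter_upwards [eventually_lt_norm_of_isCompact (hcpt e e') (hseg e e' he he') x R] with N hN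
    rintro _ ⟨k, hk, rfl⟩
    exact hN k hk
  have hpre : ∀ (N e e' : ℝ),
      IsPreconnected ((fun k => x + N * k) '' segment ℝ ((e : ℂ) * u) (e' * u')) :=
    fun N e e' => (convex_segment _ _).isPreconnected.image _ (by fun_prop)
  have hleft : ∀ (N e e' : ℝ),
      x + N * (e * u) ∈ (fun k => x + N * k) '' segment ℝ ((e : ℂ) * u) (e' * u') :=
    fun N e e' => ⟨_, left_mem_segment _ _ _, rfl⟩
  have hright : ∀ (N e e' : ℝ),
      x + N * (e' * u') ∈ (fun k => x + N * k) '' segment ℝ ((e : ℂ) * u) (e' * u') :=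
    fun N e e' => ⟨_, right_mem_segment _ _ _, rfl⟩
  have hcoord : ∀ (N e e' : ℝ), 0 ≤ N →
      ∀ t ∈ (fun k => x + N * k) '' segment ℝ ((e : ℂ) * u) (e' * u'),
        ∃ p q : ℝ, 0 ≤ p ∧ 0 ≤ q ∧ a t = p * e ∧ b t = q * e' := by
    rintro N e e' hN _ ⟨_, ⟨p, q, hp, hq, hpq, rfl⟩, rfl⟩
    refine ⟨N * p, N * q, by positivity, by positivity, ?_⟩
    have h1 := hab' (N * p * e) (N * q * e')
    have h2 : x + ((N * p * e : ℝ) : ℂ) * u + ((N * q * e' : ℝ) : ℂ) * u' =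
        x + N * (p • ((e : ℂ) * u) + q • ((e' : ℂ) * u')) := by
      simp only [Complex.real_smul]
      push_cast
      ring
    rwa [h2] at h1
  have hm1 : (-1 : ℝ) ≠ 0 := by norm_num
  obtain ⟨N, h1, h2, h3, h4, hN0, h5, h6⟩ := ((hfar 1 1 one_ne_zero one_ne_zero).and
    ((hfar 1 (-1) one_ne_zero hm1).and ((hfar (-1) (-1) hm1 hm1).and ((hfar (-1) 1 hm1
      one_ne_zero).and ((eventually_ge_atTop 0).and (hrs.and hrs')))))).exists
  set z : ℂ := x + N * u
  set z' : ℂ := x + N * u'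
  have e1 : x + N * (((1 : ℝ) : ℂ) * u) = z := by simp [z]
  have e2 : x + N * (((1 : ℝ) : ℂ) * u') = z' := by simp [z']
  let T : Set ℂ := (fun k => x + N * k) '' segment ℝ (((1 : ℝ) : ℂ) * u) (((1 : ℝ) : ℂ) * u')
  let T₁ : Set ℂ := (fun k => x + N * k) '' segment ℝ (((1 : ℝ) : ℂ) * u) (((-1 : ℝ) : ℂ) * u')
  let T₂ : Set ℂ := (fun k => x + N * k) '' segment ℝ (((-1 : ℝ) : ℂ) * u) (((-1 : ℝ) : ℂ) * u')
  let T₃ : Set ℂ := (fun k => x + N * k) '' segment ℝ (((-1 : ℝ) : ℂ) * u) (((1 : ℝ) : ℂ) * u')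
  let T' : Set ℂ := T₁ ∪ T₂ ∪ T₃
  have hT' : IsPreconnected T' :=
    ((hpre _ _ _).union _ (hright _ _ _) (hright _ _ _) (hpre _ _ _)).union _
      (Or.inr (hleft _ _ _)) (hleft _ _ _) (hpre _ _ _)
  have hzT : z ∈ T := e1 ▸ hleft N 1 1
  have hzT' : z ∈ T' := Or.inl (Or.inl (e1 ▸ hleft N 1 (-1)))
  have hz'T : z' ∈ T := e2 ▸ hright N 1 1
  have hz'T' : z' ∈ T' := Or.inr (e2 ▸ hright N (-1) 1)
  have hTR : T ⊆ {x | R < ‖x‖} := h1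
  have hTR' : T' ⊆ {x | R < ‖x‖} := Set.union_subset (Set.union_subset h2 h3) h4
  have hmeet : ∀ t, 0 ≤ a t → 0 ≤ b t → a t ≤ 0 ∨ b t ≤ 0 → t ∈ ray x u ∨ t ∈ ray x u' := by
    rintro t h1 h2 (h3 | h3)
    · refine Or.inr ⟨b t, h2, ?_⟩
      conv_rhs => rw [hab t, le_antisymm h3 h1]
      simp
    · refine Or.inl ⟨a t, h1, ?_⟩
      conv_rhs => rw [hab t, le_antisymm h3 h2]
      simp
  have hrays : ∀ t, t ∈ ray x u → t ∈ ray x u' → t = x := by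
    rintro _ ⟨p, -, rfl⟩ ⟨q, -, hq⟩
    have : (p : ℂ) * u + (-q : ℝ) * u' = 0 := by
      push_cast
      linear_combination -hq
    simp [(hind _ _ this).1]
  have hzz : (z, s l z) ∈ affineCurve P := (h.isSectionOn l hl).2 z (hTR hzT)
  have hzz' : (z', s l z') ∈ affineCurve P := (h.isSectionOn l hl).2 z' (hTR hz'T)
  have hru := isClosed_ray x hu
  have hru' := isClosed_ray x hu'
  have hac : Continuous fun w : affineCurve P => a w.1.1 := by fun_prop
  have hbc : Continuous fun w : affineCurve P => b w.1.1 := by fun_prop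
  refine not_separated_of_contractibleSpace (X := affineCurve P)
    (A := {z | 0 ≤ a z.1.1 ∧ 0 ≤ b z.1.1}) (B := {z | a z.1.1 ≤ 0 ∨ b z.1.1 ≤ 0})
    (W₁ := {z | z.1.1 ∈ ray x u ∧ z.1.2 = r z.1.1} ∪ {z | z.1.1 ∈ ray x u' ∧ z.1.2 = q z.1.1})
    (W₂ := {z | z.1.1 ∈ ray x u ∧ z.1.2 ≠ r z.1.1} ∪ {z | z.1.1 ∈ ray x u' ∧ z.1.2 ≠ q z.1.1})
    (z := ⟨(z, s l z), hzz⟩) (z' := ⟨(z', s l z'), hzz'⟩)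
    ?_ ?_ ?_ ((hr.isClosed_graph hru).union (hq.isClosed_graph hru'))
    ((hr.isClosed_compl_graph hru hray).union (hq.isClosed_compl_graph hru' hray')) ?_ ?_
    (h.isPreconnected_preimage hl (hpre _ _ _) hTR) ?_ (h.isPreconnected_preimage hl hT' hTR') ?_
    ⟨⟨hzT, rfl⟩, ⟨hzT', rfl⟩⟩ ⟨⟨hz'T, rfl⟩, ⟨hz'T', rfl⟩⟩ ?_ ?_
  · exact (isClosed_le continuous_const hac).inter (isClosed_le continuous_const hbc)
  · exact (isClosed_le hac continuous_const).union (isClosed_le hbc continuous_const)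
  · ext w
    simp only [Set.mem_union, Set.mem_ofPred_eq, Set.mem_univ, iff_true]
    by_contra! hw
    exact absurd (hw.1 hw.2.1.le) (not_lt.2 hw.2.2.le)
  · rw [Set.disjoint_left]
    rintro w (⟨hw1, hw2⟩ | ⟨hw1, hw2⟩) (⟨hw3, hw4⟩ | ⟨hw3, hw4⟩)
    · exact hw4 hw2
    · refine hw4 (hw2.trans ?_)
      rw [hrays _ hw1 hw3, hqx]
    · refine hw4 (hw2.trans ?_)
      rw [hrays _ hw3 hw1, hqx]
    · exact hw4 hw2
  · rintro w ⟨⟨hw1, hw2⟩, hw3⟩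
    rcases hmeet _ hw1 hw2 hw3 with hw | hw
    · by_cases hwr : w.1.2 = r w.1.1
      · exact Or.inl (Or.inl ⟨hw, hwr⟩)
      · exact Or.inr (Or.inl ⟨hw, hwr⟩)
    · by_cases hwr : w.1.2 = q w.1.1
      · exact Or.inl (Or.inr ⟨hw, hwr⟩)
      · exact Or.inr (Or.inr ⟨hw, hwr⟩)
  · rintro w ⟨hw, -⟩
    obtain ⟨p, q, hp, hq, h1, h2⟩ := hcoord N 1 1 hN0 _ hw
    exact ⟨by linarith, by linarith⟩
  · rintro w ⟨(hw | hw) | hw, -⟩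
    · obtain ⟨p, q, hp, hq, h1, h2⟩ := hcoord N _ _ hN0 _ hw
      exact Or.inr (by linarith)
    · obtain ⟨p, q, hp, hq, h1, h2⟩ := hcoord N _ _ hN0 _ hw
      exact Or.inr (by linarith)
    · obtain ⟨p, q, hp, hq, h1, h2⟩ := hcoord N _ _ hN0 _ hw
      exact Or.inl (by linarith)
  · exact Or.inl ⟨add_mul_mem_ray x u hN0, h5.symm⟩
  · refine Or.inr ⟨add_mul_mem_ray x u' hN0, fun hq' => hqr' _ (add_mul_mem_ray x u' hN0) ?_⟩
    exact hq'.symm.trans h6.symm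

theorem AsymptoticSections.continuesTo_unique {P : ℂ[X][Y]} {Λ : Finset ℂ} {R : ℝ}
    {s : ℂ → ℂ → ℂ} (h : AsymptoticSections P Λ R s) [ContractibleSpace (affineCurve P)] {l : ℂ}
    (hl : l ∈ Λ) {x u u' v v' : ℂ} (hv : ContinuesTo P s l x u v)
    (hv' : ContinuesTo P s l x u' v') : v = v' := by
  obtain ⟨w, hw0, hw, hwc⟩ := h.exists_good_direction (hv.2.1 (self_mem_ray x u))
    (Set.toFinite {u, u'})
  obtain ⟨ε, hε, r, -, hr⟩ := h.exists_continuesTo hl hw0 hw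
  have hr' := hr x (Metric.mem_ball_self hε)
  exact (h.continuesTo_unique_of_crossProd hl (hwc u (by simp) hv.1) hv hr').trans
    (h.continuesTo_unique_of_crossProd hl (hwc u' (by simp) hv'.1) hv' hr').symm

theorem exists_entire_extension {B : Set ℂ} (hB : B.Finite) {g : ℂ → ℂ} {b : ℂ → ℝ}
    (hb : Continuous b) (hY : ∀ x ∉ B, DifferentiableAt ℂ g x) (hYb : ∀ x ∉ B, ‖g x‖ ≤ b x) :
    ∃ Z : ℂ → ℂ, Differentiable ℂ Z ∧ ∀ x ∉ B, Z x = g x := by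
  have hZ : ∀ x ∉ B, limUnder (𝓝[≠] x) g = g x := fun x hx =>
    ((hY x hx).continuousAt.tendsto.mono_left nhdsWithin_le_nhds).limUnder_eq
  refine ⟨fun x => limUnder (𝓝[≠] x) g, fun c => ?_, hZ⟩
  let s : Set ℂ := (B \ {c})ᶜ ∩ {x | b x < b c + 1}
  have hs : s ∈ 𝓝 c := inter_mem ((hB.sdiff).isClosed.isOpen_compl.mem_nhds (by simp))
    ((isOpen_lt hb continuous_const).mem_nhds (by simp))
  have hsB : ∀ x ∈ s \ {c}, x ∉ B := fun x hx hxB => hx.1.1 ⟨hxB, hx.2⟩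
  have h := Complex.differentiableOn_update_limUnder_of_bddAbove hs
    (fun x hx => (hY x (hsB x hx)).differentiableWithinAt)
    ⟨b c + 1, by
      rintro _ ⟨x, hx, rfl⟩
      exact (hYb x (hsB x hx)).trans (le_of_lt hx.1.2)⟩
  refine (h.differentiableAt hs).congr_of_eventuallyEq ?_
  filter_upwards [hs] with x hx
  by_cases hxc : x = c
  · simp [hxc]
  · rw [Function.update_of_ne hxc]
    exact hZ x (hsB x ⟨hx, hxc⟩)

theorem Differentiable.eq_affine_of_tendsto_div {Z : ℂ → ℂ} (hZ : Differentiable ℂ Z) {l : ℂ}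
    (hl : Tendsto (fun x => Z x / x) (cocompact ℂ) (𝓝 l)) (x : ℂ) : Z x = l * x + Z 0 := by
  have h0 : ∀ᶠ x : ℂ in cocompact ℂ, x ≠ 0 :=
    (isCompact_singleton (x := (0 : ℂ))).compl_mem_cocompact
  have hd : Differentiable ℂ (dslope Z 0) := by
    rw [← differentiableOn_univ, Complex.differentiableOn_dslope univ_mem]
    exact hZ.differentiableOn
  have ht : Tendsto (dslope Z 0) (cocompact ℂ) (𝓝 l) := by
    have h1 : Tendsto (fun x : ℂ => x⁻¹) (cocompact ℂ) (𝓝 0) := by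
      rw [← Metric.cobounded_eq_cocompact]
      exact tendsto_inv₀_cobounded
    have h2 := hl.sub (h1.const_mul (Z 0))
    rw [mul_zero, sub_zero] at h2
    refine h2.congr' ?_
    filter_upwards [h0] with x hx
    rw [dslope_of_ne _ hx, slope_def_field, sub_zero]
    field_simp
  have h3 := hd.apply_eq_of_tendsto_cocompact x ht
  by_cases hx : x = 0
  · simp [hx]
  · rw [dslope_of_ne _ hx, slope_def_field, sub_zero, div_eq_iff hx] at h3
    linear_combination h3

theorem AsymptoticSections.exists_line {P : ℂ[X][Y]} {Λ : Finset ℂ} {R : ℝ}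
    {s : ℂ → ℂ → ℂ} (h : AsymptoticSections P Λ R s) [ContractibleSpace (affineCurve P)] {l : ℂ}
    (hl : l ∈ Λ) : ∃ k, ∀ x, (x, l * x + k) ∈ affineCurve P := by
  have hex : ∀ x ∈ regularLocus P, ∃ u ε r, 0 < ε ∧ IsSectionOn P r (Metric.ball x ε) ∧
      ∀ y ∈ Metric.ball x ε, ContinuesTo P s l y u (r y) := by
    intro x hx
    obtain ⟨w, hw0, hw, -⟩ := h.exists_good_direction hx Set.finite_empty
    obtain ⟨ε, hε, r, hr⟩ := h.exists_continuesTo hl hw0 hw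
    exact ⟨w, ε, r, hε, hr⟩
  have hY : ∀ x, ∃ y, x ∈ regularLocus P → ∃ u, ContinuesTo P s l x u y := by
    intro x
    by_cases hx : x ∈ regularLocus P
    · obtain ⟨u, ε, r, hε, -, hr⟩ := hex x hx
      exact ⟨r x, fun _ => ⟨u, hr x (Metric.mem_ball_self hε)⟩⟩
    · exact ⟨0, fun h => absurd h hx⟩
  choose g hY using hY
  have huniq : ∀ x u v, ContinuesTo P s l x u v → g x = v := by
    intro x u v hv
    obtain ⟨u', hu'⟩ := hY x (hv.2.1 (self_mem_ray x u))
    exact h.continuesTo_unique hl hu' hv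
  have hcurve : ∀ x ∈ regularLocus P, (x, g x) ∈ affineCurve P := by
    intro x hx
    obtain ⟨u, -, -, r, hr, hrx, -⟩ := hY x hx
    rw [← hrx]
    exact hr.2 x (self_mem_ray x u)
  have hdiff : ∀ x ∈ regularLocus P, DifferentiableAt ℂ g x := by
    intro x hx
    obtain ⟨u, ε, r, hε, hr, hru⟩ := hex x hx
    have hball := Metric.ball_mem_nhds x hε
    have hYr : g =ᶠ[𝓝 x] r := by
      filter_upwards [hball] with y hy
      exact huniq y u _ (hru y hy)
    have hcont : ContinuousAt g x := (hr.1.continuousAt hball).congr hYr.symm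
    obtain ⟨ψ, hψd, -, hψ⟩ := exists_local_graph (hcurve x hx) hx
    refine hψd.congr_of_eventuallyEq ?_
    have ht : Tendsto (fun t => (t, g t)) (𝓝 x) (𝓝 (x, g x)) :=
      tendsto_id.prodMk_nhds hcont.tendsto
    filter_upwards [ht.eventually hψ, (isOpen_regularLocus h.monic).mem_nhds hx] with t ht htr
    exact (ht.1 (hcurve t htr)).symm
  have hfar : ∀ x, R < ‖x‖ → g x = s l x := by
    intro x hx
    have hray : ray x x ⊆ {x | R < ‖x‖} := by
      rintro _ ⟨t, ht, rfl⟩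
      have ht' : (0 : ℝ) ≤ t := ht
      have : x + t * x = ((1 + t : ℝ) : ℂ) * x := by push_cast; ring
      change R < ‖x + t * x‖
      rw [this, norm_mul, Complex.norm_real, Real.norm_eq_abs, abs_of_nonneg (by linarith)]
      nlinarith [norm_nonneg x]
    exact huniq x x _ ⟨norm_pos_iff.1 (h.pos.trans hx), hray.trans h.subset_regularLocus, s l,
      (h.isSectionOn l hl).mono hray, rfl, Eventually.of_forall fun _ => rfl⟩
  obtain ⟨b, hb, hbP⟩ := exists_continuous_root_bound h.monic
  have hfin := h.finite_compl_regularLocus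
  obtain ⟨Z, hZ, hZY⟩ := exists_entire_extension hfin hb
    (fun x hx => hdiff x (not_not.1 hx)) (fun x hx => hbP _ (hcurve x (not_not.1 hx)))
  have hZl : Tendsto (fun x => Z x / x) (cocompact ℂ) (𝓝 l) := by
    refine (h.tendsto l hl).congr' ?_
    filter_upwards [(isCompact_closedBall (0 : ℂ) R).compl_mem_cocompact] with x hx
    have hx' : R < ‖x‖ := by simpa using hx
    rw [hZY x (not_not.2 (h.subset_regularLocus hx')), hfar x hx']
  refine ⟨Z 0, fun x => ?_⟩
  have hclosed : IsClosed {x : ℂ | (x, l * x + Z 0) ∈ affineCurve P} :=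
    (isClosed_affineCurve P).preimage (by fun_prop)
  have hdense : Dense (regularLocus P) := by
    have := hfin.countable.dense_compl ℝ
    rwa [compl_compl] at this
  have hsub : regularLocus P ⊆ {x : ℂ | (x, l * x + Z 0) ∈ affineCurve P} := by
    intro x hx
    change (x, l * x + Z 0) ∈ affineCurve P
    rw [← hZ.eq_affine_of_tendsto_div hZl x, hZY x (not_not.2 hx)]
    exact hcurve x hx
  have := hclosed.closure_subset_iff.2 hsub (hdense x)
  exact this

/-- The curve `P = 0` is a union of lines with pairwise distinct slopes. -/
theorem AsymptoticSections.exists_eq_prod {P : ℂ[X][Y]} {Λ : Finset ℂ} {R : ℝ}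
    {s : ℂ → ℂ → ℂ} (h : AsymptoticSections P Λ R s) [ContractibleSpace (affineCurve P)] :
    ∃ k : ℂ → ℂ, ∀ x y, P.evalEval x y = ∏ l ∈ Λ, (y - (l * x + k l)) := by
  have hk : ∀ l, ∃ k, l ∈ Λ → ∀ x, (x, l * x + k) ∈ affineCurve P := by
    intro l
    by_cases hl : l ∈ Λ
    · obtain ⟨k, hk⟩ := h.exists_line hl
      exact ⟨k, fun _ => hk⟩
    · exact ⟨0, fun h => absurd h hl⟩
  choose k hk using hk
  refine ⟨k, fun x y => ?_⟩
  let L : ℂ → ℂ[X] := fun l => Polynomial.C l * Polynomial.X + Polynomial.C (k l)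
  have hP : P = ∏ l ∈ Λ, (Polynomial.X - Polynomial.C (L l)) := by
    refine h.monic.eq_prod_X_sub_C (fun l _ l' _ hll => ?_) h.natDegree_eq fun l hl => ?_
    · simpa [L] using congr_arg (fun p => Polynomial.coeff p 1) hll
    · refine Polynomial.funext fun t => ?_
      have h1 := hk l hl t
      rw [mem_affineCurve, ← Polynomial.eval₂_evalRingHom] at h1
      have h2 := Polynomial.hom_eval₂ P (RingHom.id _) (Polynomial.evalRingHom t) (L l)
      simp only [RingHom.comp_id, Polynomial.eval₂_id, Polynomial.coe_evalRingHom] at h2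
      rw [h2, Polynomial.eval_zero, ← h1]
      simp [L]
  rw [hP, Polynomial.evalEval_prod]
  simp [L, Polynomial.evalEval_C]

/-- Lines of pairwise distinct slopes with contractible union are concurrent. -/
theorem exists_common_point {P : ℂ[X][Y]} [ContractibleSpace (affineCurve P)] {Λ : Finset ℂ}
    {k : ℂ → ℂ} (hP : ∀ x y, P.evalEval x y = ∏ l ∈ Λ, (y - (l * x + k l))) :
    ∃ x y, ∀ l ∈ Λ, y = l * x + k l := by
  rcases Λ.eq_empty_or_nonempty with rfl | ⟨l₁, h₁⟩
  · simp
  by_cases h : ∃ l₂ ∈ Λ, l₂ ≠ l₁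
  swap
  · push Not at h
    exact ⟨0, k l₁, fun l hl => by simp [h l hl]⟩
  obtain ⟨l₂, h₂, h₁₂⟩ := h
  have hmem : ∀ {x y}, (x, y) ∈ affineCurve P ↔ ∃ l ∈ Λ, y = l * x + k l := fun {x y} => by
    rw [mem_affineCurve, hP, Finset.prod_eq_zero_iff]
    simp only [sub_eq_zero]
  let ℓ : ℂ → Set (affineCurve P) := fun l => {z | z.1.2 = l * z.1.1 + k l}
  have hℓc : ∀ l, IsClosed (ℓ l) := fun l => isClosed_eq (by fun_prop) (by fun_prop)
  have hℓp : ∀ l ∈ Λ, IsPreconnected (ℓ l) := by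
    intro l hl
    have : ℓ l = Set.range fun x : ℂ =>
        (⟨(x, l * x + k l), hmem.2 ⟨l, hl, rfl⟩⟩ : affineCurve P) := by
      ext ⟨⟨x, y⟩, hz⟩
      simp only [ℓ, Set.mem_ofPred_eq, Set.mem_range, Subtype.mk.injEq, Prod.mk.injEq,
        exists_eq_left]
      exact eq_comm
    rw [this]
    exact isPreconnected_range (by fun_prop)
  have hmeet : ∀ l ∈ Λ, ∀ l', l ≠ l' → ∃ z, z ∈ ℓ l ∩ ℓ l' := by
    intro l hl l' hll
    have hll' : l - l' ≠ 0 := sub_ne_zero.2 hll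
    refine ⟨⟨((k l' - k l) / (l - l'), l * ((k l' - k l) / (l - l')) + k l),
      hmem.2 ⟨l, hl, rfl⟩⟩, rfl, ?_⟩
    change l * ((k l' - k l) / (l - l')) + k l = l' * ((k l' - k l) / (l - l')) + k l'
    field_simp
    ring
  have hone : ∀ l l', l ≠ l' → ∀ z ∈ ℓ l ∩ ℓ l', ∀ z' ∈ ℓ l ∩ ℓ l', z = z' := by
    rintro l l' hll ⟨⟨x, y⟩, hz⟩ ⟨h1, h2⟩ ⟨⟨x', y'⟩, hz'⟩ ⟨h3, h4⟩
    change y = l * x + k l at h1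
    change y = l' * x + k l' at h2
    change y' = l * x' + k l at h3
    change y' = l' * x' + k l' at h4
    have hx : x = x' := mul_left_cancel₀ (sub_ne_zero.2 hll)
      (by linear_combination h2 - h1 - h4 + h3)
    subst hx
    simp [h1, h3]
  obtain ⟨p, hp₁, hp₂⟩ := hmeet l₁ h₁ l₂ h₁₂.symm
  refine ⟨p.1.1, p.1.2, fun l hl => ?_⟩
  change p ∈ ℓ l
  by_contra hpl
  have hl₁ : l ≠ l₁ := fun e => hpl (e ▸ hp₁)
  have hl₂ : l ≠ l₂ := fun e => hpl (e ▸ hp₂)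
  obtain ⟨q, hq₁, hq⟩ := hmeet l₁ h₁ l hl₁.symm
  obtain ⟨r, hr₂, hr⟩ := hmeet l₂ h₂ l hl₂.symm
  let B : Set (affineCurve P) := ⋃ l' ∈ Λ.erase l₁, ℓ l'
  have hB : ∀ l' ∈ Λ, l' ≠ l₁ → ℓ l' ⊆ B := fun l' hl' hne =>
    Set.subset_biUnion_of_mem (u := ℓ) (Finset.mem_erase.2 ⟨hne, hl'⟩)
  have hfin : (ℓ l₁ ∩ B).Finite := by
    rw [Set.inter_iUnion₂]
    refine (Finset.finite_toSet _).biUnion fun l' hl' => Set.Subsingleton.finite ?_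
    exact fun z hz z' hz' => hone l₁ l' (Finset.ne_of_mem_erase hl').symm z hz z' hz'
  refine not_separated_of_contractibleSpace (A := ℓ l₁) (B := B) (W₁ := {p})
    (W₂ := (ℓ l₁ ∩ B) \ {p}) (S := ℓ l₁) (S' := ℓ l₂ ∪ ℓ l) (z := p) (z' := q) (hℓc l₁)
    (isClosed_biUnion_finset fun l' _ => hℓc l') ?_ isClosed_singleton hfin.sdiff.isClosed
    Set.disjoint_sdiff_right (fun z hz => ?_) (hℓp l₁ h₁) subset_rfl
    ((hℓp l₂ h₂).union r hr₂ hr (hℓp l hl)) (Set.union_subset (hB l₂ h₂ h₁₂) (hB l hl hl₁))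
    ⟨hp₁, Or.inl hp₂⟩ ⟨hq₁, Or.inr hq⟩ rfl
    ⟨⟨hq₁, hB l hl hl₁ hq⟩, fun e => hpl (Set.mem_singleton_iff.1 e ▸ hq)⟩
  · refine Set.eq_univ_of_forall ?_
    rintro ⟨⟨x, y⟩, hz⟩
    obtain ⟨l', hl', hy⟩ := hmem.1 hz
    by_cases e : l' = l₁
    · exact Or.inl (e ▸ hy)
    · exact Or.inr (hB l' hl' e hy)
  · by_cases e : z = p
    · exact Or.inl e
    · exact Or.inr ⟨hz, e⟩

theorem evalEval_aeval_pair (φ : MvPolynomial (Fin 2) ℂ) (a : ℂ[X]) (x y : ℂ) :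
    (MvPolynomial.aeval ![Polynomial.X, Polynomial.C a] φ : ℂ[X][Y]).evalEval x y =
      MvPolynomial.eval ![y, a.eval x] φ := by
  induction φ using MvPolynomial.induction_on with
  | C c => simp [Polynomial.algebraMap_apply, Polynomial.evalEval_C]
  | add p q hp hq => simp [hp, hq, Polynomial.evalEval_add]
  | mul_X p i hp =>
    rw [map_mul, map_mul, Polynomial.evalEval_mul, hp]
    fin_cases i <;> simp [Polynomial.evalEval_C]

theorem eval_aeval_X_one (φ : MvPolynomial (Fin 2) ℂ) (x : ℂ) :
    (MvPolynomial.aeval ![(Polynomial.X : ℂ[X]), 1] φ).eval x = MvPolynomial.eval ![x, 1] φ := by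
  induction φ using MvPolynomial.induction_on with
  | C c => simp
  | add p q hp hq => simp [hp, hq]
  | mul_X p i hp =>
    rw [map_mul, map_mul, Polynomial.eval_mul, hp]
    fin_cases i <;> simp

theorem exists_eq_of_contractibleSpace {d : ℕ} {f : MvPolynomial (Fin 2) ℂ}
    (hdeg : f.totalDegree = d) (htrans : Squarefree (homogeneousComponent d f))
    (hcontr : ContractibleSpace {x : Fin 2 → ℂ // MvPolynomial.eval x f = 0})
    (hf : MvPolynomial.eval ![1, 0] (homogeneousComponent d f) ≠ 0) :
    ∃ (A : (Fin 2 → ℂ) ≃ᵃ[ℂ] (Fin 2 → ℂ)) (g : MvPolynomial (Fin 2) ℂ),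
      g.IsHomogeneous d ∧ ∀ x : Fin 2 → ℂ, MvPolynomial.eval x f = MvPolynomial.eval (A x) g := by
  set c := MvPolynomial.eval ![1, 0] (homogeneousComponent d f) with hc
  have hhom := fun k => homogeneousComponent_isHomogeneous k f
  have hsum : ∑ k ∈ Finset.range (d + 1), homogeneousComponent k f = f :=
    hdeg ▸ sum_homogeneousComponent f
  let ev : ℂ[X] → MvPolynomial (Fin 2) ℂ →ₐ[ℂ] ℂ[X][Y] := fun a =>
    MvPolynomial.aeval ![Polynomial.X, Polynomial.C a]
  have hmonic : ∀ F : ℕ → ℂ[X][Y], (∀ k, (F k).natDegree ≤ k) →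
      (F d).coeff d = Polynomial.C c →
      (Polynomial.C (Polynomial.C c⁻¹) * ∑ k ∈ Finset.range (d + 1), F k).Monic ∧
      (Polynomial.C (Polynomial.C c⁻¹) * ∑ k ∈ Finset.range (d + 1), F k).natDegree = d := by
    intro F hF hFd
    obtain ⟨h1, h2⟩ := Polynomial.coeff_sum_of_natDegree_le hF d
    have h3 : (Polynomial.C (Polynomial.C c⁻¹) * ∑ k ∈ Finset.range (d + 1), F k).coeff d = 1 := by
      rw [Polynomial.coeff_C_mul, h2, hFd, ← Polynomial.C_mul, inv_mul_cancel₀ hf, Polynomial.C_1]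
    have h4 := (Polynomial.natDegree_C_mul_le (Polynomial.C c⁻¹) _).trans h1
    exact ⟨Polynomial.monic_of_natDegree_le_of_coeff_eq_one d h4 h3,
      h4.antisymm (Polynomial.le_natDegree_of_ne_zero (by rw [h3]; exact one_ne_zero))⟩
  let P : ℂ[X][Y] := Polynomial.C (Polynomial.C c⁻¹) *
    ∑ k ∈ Finset.range (d + 1), ev Polynomial.X (homogeneousComponent k f)
  let Q : ℂ[X][Y] := Polynomial.C (Polynomial.C c⁻¹) *
    ∑ k ∈ Finset.range (d + 1),
      Polynomial.C (Polynomial.X ^ (d - k)) * ev 1 (homogeneousComponent k f)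
  obtain ⟨hP, hPd⟩ : P.Monic ∧ P.natDegree = d :=
    hmonic _ (fun k => (hhom k).natDegree_aeval_pair_le _) ((hhom d).coeff_aeval_pair _)
  obtain ⟨hQ, hQd⟩ : Q.Monic ∧ Q.natDegree = d := by
    refine hmonic _ (fun k => (Polynomial.natDegree_C_mul_le _ _).trans
      ((hhom k).natDegree_aeval_pair_le _)) ?_
    rw [Nat.sub_self, pow_zero, Polynomial.C_1, one_mul]
    exact (hhom d).coeff_aeval_pair _
  have hPe : ∀ x y, P.evalEval x y = c⁻¹ * MvPolynomial.eval ![y, x] f := by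
    intro x y
    rw [← hsum]
    simp only [P, ev, Polynomial.evalEval_mul, Polynomial.evalEval_finsetSum,
      evalEval_aeval_pair, Polynomial.evalEval_C, Polynomial.eval_C, Polynomial.eval_X, map_sum]
  have hQe : ∀ w m, Q.evalEval w m = c⁻¹ * ∑ k ∈ Finset.range (d + 1),
      w ^ (d - k) * MvPolynomial.eval ![m, 1] (homogeneousComponent k f) := by
    intro w m
    simp only [Q, ev, Polynomial.evalEval_mul, Polynomial.evalEval_finsetSum,
      evalEval_aeval_pair, Polynomial.evalEval_C, Polynomial.eval_C, Polynomial.eval_X,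
      Polynomial.eval_pow, Polynomial.eval_one]
  have hPQ : ∀ x y : ℂ, x ≠ 0 →
      P.evalEval x y = x ^ Q.natDegree * Q.evalEval x⁻¹ (x⁻¹ * y) := by
    intro x y hx
    rw [hPe, hQe, hQd, mul_left_comm, Finset.mul_sum, ← hsum, map_sum]
    congr 1
    refine Finset.sum_congr rfl fun k hk => ?_
    have hk' : k ≤ d := Nat.lt_succ_iff.1 (Finset.mem_range.1 hk)
    have h1 := (hhom k).eval_pair_mul x (x⁻¹ * y) 1
    rw [mul_one, mul_inv_cancel_left₀ hx] at h1
    rw [hsum, h1, ← mul_assoc]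
    congr 1
    rw [inv_pow, ← pow_sub₀ x hx (Nat.sub_le d k), Nat.sub_sub_self hk']
  have hsep : (fiberPoly Q 0).Separable := by
    have h1 : fiberPoly Q 0 = Polynomial.C c⁻¹ *
        MvPolynomial.aeval ![(Polynomial.X : ℂ[X]), 1] (homogeneousComponent d f) := by
      refine Polynomial.funext fun m => ?_
      rw [fiberPoly_eval, hQe, Polynomial.eval_mul, Polynomial.eval_C, eval_aeval_X_one,
        Finset.sum_range_succ, Finset.sum_eq_zero, zero_add, Nat.sub_self, pow_zero, one_mul]
      intro k hk
      rw [zero_pow (Nat.sub_ne_zero_of_lt (Finset.mem_range.1 hk)), zero_mul]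
    rw [PerfectField.separable_iff_squarefree, h1]
    have h3 : IsUnit (Polynomial.C c⁻¹) := Polynomial.isUnit_C.2 (inv_ne_zero hf).isUnit
    exact (associated_unit_mul_left _ _ h3).symm.squarefree_iff.1
      ((hhom d).squarefree_aeval_X_one htrans)
  obtain ⟨Λ, R, s, hs⟩ := exists_asymptoticSections hP hQ (hPd.trans hQd.symm) hPQ hsep
  let e : {x : Fin 2 → ℂ // MvPolynomial.eval x f = 0} ≃ₜ affineCurve P :=
    { toFun := fun v => ⟨(v.1 1, v.1 0), by
        have h : ![v.1 0, v.1 1] = v.1 := by ext i; fin_cases i <;> rfl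
        rw [mem_affineCurve, hPe, h, v.2, mul_zero]⟩
      invFun := fun z => ⟨![z.1.2, z.1.1], by
        have h := z.2
        change P.evalEval z.1.1 z.1.2 = 0 at h
        rw [hPe] at h
        exact (mul_eq_zero.1 h).resolve_left (inv_ne_zero hf)⟩
      left_inv := fun v => by
        ext i
        fin_cases i <;> rfl
      right_inv := fun z => rfl
      continuous_toFun := by
        refine Continuous.subtype_mk ?_ _
        exact ((continuous_apply 1).comp continuous_subtype_val).prodMk
          ((continuous_apply 0).comp continuous_subtype_val)
      continuous_invFun := by
        refine Continuous.subtype_mk ?_ _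
        fun_prop }
  have : ContractibleSpace (affineCurve P) := e.symm.contractibleSpace
  obtain ⟨k, hk⟩ := hs.exists_eq_prod
  obtain ⟨x₀, y₀, h₀⟩ := exists_common_point hk
  refine ⟨AffineEquiv.constVAdd ℂ (Fin 2 → ℂ) (-![y₀, x₀]),
    MvPolynomial.C c * ∏ l ∈ Λ, (MvPolynomial.X 0 - MvPolynomial.C l * MvPolynomial.X 1), ?_, ?_⟩
  · have h1 : (∏ l ∈ Λ, (MvPolynomial.X 0 - MvPolynomial.C l * MvPolynomial.X 1 :
        MvPolynomial (Fin 2) ℂ)).IsHomogeneous (∑ _l ∈ Λ, 1) :=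
      IsHomogeneous.prod _ _ _ fun l _ => (isHomogeneous_X ℂ 0).sub (isHomogeneous_C_mul_X l 1)
    have h2 := (isHomogeneous_C (Fin 2) c).mul h1
    rwa [zero_add, Finset.sum_const, smul_eq_mul, mul_one, ← hs.natDegree_eq, hPd] at h2
  · intro v
    have hv : ![v 0, v 1] = v := by ext i; fin_cases i <;> rfl
    have h1 := hPe (v 1) (v 0)
    rw [hv, hk, eq_inv_mul_iff_mul_eq₀ hf] at h1
    rw [← h1, map_mul, MvPolynomial.eval_C, map_prod]
    congr 1
    refine Finset.prod_congr rfl fun l hl => ?_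
    simp only [map_sub, map_mul, MvPolynomial.eval_X, MvPolynomial.eval_C,
      AffineEquiv.constVAdd_apply, vadd_eq_add, Pi.add_apply, Pi.neg_apply,
      Matrix.cons_val_zero, Matrix.cons_val_one]
    linear_combination h₀ l hl

end BivariateCurve

theorem contractible_curve_is_homogeneous
    (d : ℕ) (hd : 0 < d)
    (f : MvPolynomial (Fin 2) ℂ)
    -- `f` is reduced of degree `d`
    (hred : Squarefree f) (hdeg : f.totalDegree = d)
    -- `f` is transversal at infinity: the projective closure `V` meets the line at
    -- infinity in `d` distinct points, i.e. the top-degree part of `f` is squarefree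
    (htrans : Squarefree ((homogeneousComponent d) f))
    -- `μ = 0`: the affine curve `F₀ = f⁻¹(0)` is contractible
    (hcontr : ContractibleSpace {x : Fin 2 → ℂ // eval x f = 0}) :
    ∃ (A : (Fin 2 → ℂ) ≃ᵃ[ℂ] (Fin 2 → ℂ)) (g : MvPolynomial (Fin 2) ℂ),
      g.IsHomogeneous d ∧ ∀ x : Fin 2 → ℂ, eval x f = eval (A x) g := by
  have hhom := homogeneousComponent_isHomogeneous d f
  obtain ⟨q, hq⟩ : ∃ q, eval q (homogeneousComponent d f) ≠ 0 := by
    by_contra! h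
    exact htrans.ne_zero (MvPolynomial.funext fun q => by rw [h q, map_zero])
  have hqv : ![q 0, q 1] = q := by ext i; fin_cases i <;> rfl
  let M : Matrix (Fin 2) (Fin 2) ℂ := !![q 0, -star (q 1); q 1, star (q 0)]
  have hdet : M.det ≠ 0 := by
    intro h
    have h1 : ((Complex.normSq (q 0) + Complex.normSq (q 1) : ℝ) : ℂ) = 0 := by
      rw [Complex.ofReal_add, ← Complex.mul_conj, ← Complex.mul_conj, ← h, Matrix.det_fin_two_of]
      simp only [starRingEnd_apply]
      ring
    rw [Complex.ofReal_eq_zero,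
      add_eq_zero_iff_of_nonneg (Complex.normSq_nonneg _) (Complex.normSq_nonneg _),
      Complex.normSq_eq_zero, Complex.normSq_eq_zero] at h1
    have h2 := hhom.eval_pair_mul 0 0 0
    rw [zero_mul, zero_pow hd.ne', zero_mul] at h2
    rw [← hqv, h1.1, h1.2, h2] at hq
    exact hq rfl
  have hMN : M * M⁻¹ = 1 := M.mul_nonsing_inv hdet.isUnit
  have hNM : M⁻¹ * M = 1 := M.nonsing_inv_mul hdet.isUnit
  let T := Matrix.toLin'OfInv hNM hMN
  have hT : ∀ v, T v = M.mulVec v := fun v => rfl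
  let F := bind₁ M.toMvPolynomial f
  have hF : ∀ v, eval v F = eval (T v) f := fun v => by
    rw [hT]; exact eval_bind₁_toMvPolynomial M v f
  have hFcomp : homogeneousComponent d F = bind₁ M.toMvPolynomial (homogeneousComponent d f) :=
    homogeneousComponent_bind₁_toMvPolynomial M f d
  have hFq : eval ![1, 0] (homogeneousComponent d F) ≠ 0 := by
    have : M.mulVec ![1, 0] = q := by
      ext i
      fin_cases i <;> simp [M]
    rwa [hFcomp, eval_bind₁_toMvPolynomial, this]
  have hFtrans : Squarefree (homogeneousComponent d F) := by
    rw [hFcomp]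
    exact htrans.bind₁_toMvPolynomial hMN
  have hFdeg : F.totalDegree = d := by
    refine ((totalDegree_bind₁_toMvPolynomial_le M f).trans_eq hdeg).antisymm (le_of_not_gt ?_)
    exact fun h => hFtrans.ne_zero (homogeneousComponent_eq_zero d F h)
  let e : {x // eval x f = 0} ≃ₜ {x // eval x F = 0} :=
    T.symm.toContinuousLinearEquiv.toHomeomorph.subtype fun x => by
      change eval x f = 0 ↔ eval (T.symm x) F = 0
      rw [hF, LinearEquiv.apply_symm_apply]
  obtain ⟨A, g, hg, hA⟩ := exists_eq_of_contractibleSpace hFdeg hFtrans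
    e.symm.contractibleSpace hFq
  refine ⟨T.symm.toAffineEquiv.trans A, g, hg, fun x => ?_⟩
  have := hA (T.symm x)
  rw [hF, LinearEquiv.apply_symm_apply] at this
  exact this
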